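/- arXiv:1206.5728 — 2 statements merged into one kernel-verified Lean document; each statement's English description precedes it below -/
import Mathlib

section
/- Let n = 2. There is a group isomorphism from H₁(C(ρ)) onto ℤ² × (ℤ/2ℤ) under which the class ⟦ρ⟧ corresponds to the element ((1,0), 0); in particular ⟦ρ⟧ has infinite order and is a primitive element of the free abelian part. -/
/-- Any group element lies in the centralizer of the singleton consisting of itself. -/
theorem mem_centralizer_self {G : Type*} [Group G] (g : G) :
    g ∈ Subgroup.centralizer {g} := by
  rw [Subgroup.mem_centralizer_iff]
  rintro h hh
  rw [Set.mem_singleton_iff] at hh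
  rw [hh]

namespace NielsenCentralizer

/-- The free group of rank two. -/
abbrev F : Type := FreeGroup (Fin 2)

/-- The first basis element. -/
abbrev a : F := FreeGroup.of 0

/-- The second basis element. -/
abbrev b : F := FreeGroup.of 1

/-- The product `a ^ e₁ * b ^ j₁ * ⋯ * a ^ eₙ * b ^ jₙ` of a list of syllables `(eₖ, jₖ)`. -/
def eval : List (ℤˣ × ℤ) → F
  | [] => 1
  | p :: l => a ^ (p.1 : ℤ) * b ^ p.2 * eval l

/-- A list of syllables is reduced if it has no subword `a ^ e * b ^ 0 * a ^ (-e)`. -/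
def Reduced (l : List (ℤˣ × ℤ)) : Prop :=
  l.IsChain fun p q => p.2 = 0 → p.1 = q.1

theorem eval_append (l l' : List (ℤˣ × ℤ)) : eval (l ++ l') = eval l * eval l' := by
  induction l with
  | nil => simp [eval]
  | cons p l ih => simp [eval, ih, mul_assoc]

theorem Reduced.tail {p : ℤˣ × ℤ} {l : List (ℤˣ × ℤ)} (h : Reduced (p :: l)) : Reduced l :=
  List.IsChain.tail h

/-- The HNN extension of an infinite cyclic group along the trivial subgroup. -/
abbrev Ext : Type :=
  HNNExtension (Multiplicative ℤ) ⊥ ⊥ (MulEquiv.refl (⊥ : Subgroup (Multiplicative ℤ)))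

/-- The map to the HNN extension that sends `a` to the stable letter. -/
def toExt : F →* Ext :=
  FreeGroup.lift ![HNNExtension.t, HNNExtension.of (Multiplicative.ofAdd 1)]

/-- A reduced list of syllables, as a reduced word of the HNN extension. -/
def reducedWord (i : ℤ) (l : List (ℤˣ × ℤ)) (hl : Reduced l) :
    HNNExtension.NormalWord.ReducedWord (Multiplicative ℤ) ⊥ ⊥ where
  head := Multiplicative.ofAdd i
  toList := l.map fun p => (p.1, Multiplicative.ofAdd p.2)
  chain := by
    rw [List.isChain_map]
    refine List.IsChain.imp ?_ hl
    intro p q h hp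
    apply h
    have : Multiplicative.ofAdd p.2 = 1 := by
      rcases Int.units_eq_one_or p.1 with h1 | h1 <;> simpa [h1] using hp
    simpa using this

theorem prod_reducedWord (i : ℤ) (l : List (ℤˣ × ℤ)) (hl : Reduced l) :
    (reducedWord i l hl).prod (MulEquiv.refl _) = toExt (b ^ i * eval l) := by
  have hof (j : ℤ) : (HNNExtension.of (Multiplicative.ofAdd j) : Ext) = toExt (b ^ j) := by
    rw [map_zpow, toExt, FreeGroup.lift_apply_of]
    simp [← map_zpow, ← ofAdd_zsmul]
  have ht (e : ℤˣ) : (HNNExtension.t ^ (e : ℤ) : Ext) = toExt (a ^ (e : ℤ)) := by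
    rw [map_zpow, toExt, FreeGroup.lift_apply_of]
    simp
  have key : ∀ l : List (ℤˣ × ℤ), ((l.map fun p => (p.1, Multiplicative.ofAdd p.2)).map
      fun x => (HNNExtension.t ^ (x.1 : ℤ) * HNNExtension.of x.2 : Ext)).prod
        = toExt (eval l) := by
    intro l
    induction l with
    | nil => simp [eval]
    | cons p l ih =>
      rw [List.map_cons, List.map_cons, List.prod_cons, ih, eval, map_mul, map_mul, hof, ht]
  rw [HNNExtension.NormalWord.ReducedWord.prod, map_mul, ← hof]
  exact congrArg _ (key l)

theorem head_eq_of_eval_eq {i i' : ℤ} {l l' : List (ℤˣ × ℤ)} (hl : Reduced l) (hl' : Reduced l')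
    (h : b ^ i * eval l = b ^ i' * eval l') :
    l.map Prod.fst = l'.map Prod.fst ∧ i = i' := by
  have hp : (reducedWord i l hl).prod (MulEquiv.refl _) =
      (reducedWord i' l' hl').prod (MulEquiv.refl _) := by
    rw [prod_reducedWord, prod_reducedWord, h]
  obtain ⟨h1, h2⟩ := HNNExtension.ReducedWord.map_fst_eq_and_of_prod_eq _ hp
  have h1' : l.map Prod.fst = l'.map Prod.fst := by
    simpa [reducedWord, Function.comp_def] using h1
  refine ⟨h1', ?_⟩
  cases l with
  | nil =>
    have : l' = [] := by simpa using h1'.symm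
    subst this
    simp only [eval, mul_one] at h
    have := congrArg (FreeGroup.lift fun _ => Multiplicative.ofAdd (1 : ℤ)) h
    simpa [← ofAdd_zsmul] using this
  | cons p l =>
    have := h2 p.1 (by simp [reducedWord])
    rcases Int.units_eq_one_or p.1 with h3 | h3 <;> rw [h3] at this <;>
      simp [reducedWord, ← ofAdd_neg, ← ofAdd_add] at this <;> omega

theorem eval_unique {i i' : ℤ} {l l' : List (ℤˣ × ℤ)} (hl : Reduced l) (hl' : Reduced l')
    (h : b ^ i * eval l = b ^ i' * eval l') : i = i' ∧ l = l' := by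
  induction l generalizing i i' l' with
  | nil =>
    obtain ⟨h1, rfl⟩ := head_eq_of_eval_eq hl hl' h
    exact ⟨rfl, by simpa using h1.symm⟩
  | cons p l ih =>
    obtain ⟨h1, rfl⟩ := head_eq_of_eval_eq hl hl' h
    cases l' with
    | nil => simp at h1
    | cons p' l' =>
      obtain ⟨e, j⟩ := p
      obtain ⟨e', j'⟩ := p'
      obtain ⟨rfl, -⟩ : e = e' ∧ _ := by simpa using h1
      obtain ⟨rfl, rfl⟩ := ih hl.tail hl'.tail (i := j) (i' := j')
        (by simpa [eval, mul_assoc] using h)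
      exact ⟨rfl, rfl⟩

theorem exists_reduced (g : F) : ∃ (i : ℤ) (l : List (ℤˣ × ℤ)), Reduced l ∧
    g = b ^ i * eval l := by
  have hb (j : ℤ) (g : F) : (∃ (i : ℤ) (l : List (ℤˣ × ℤ)), Reduced l ∧ g = b ^ i * eval l) →
      ∃ (i : ℤ) (l : List (ℤˣ × ℤ)), Reduced l ∧ b ^ j * g = b ^ i * eval l := by
    rintro ⟨i, l, hl, rfl⟩
    exact ⟨j + i, l, hl, by rw [zpow_add, mul_assoc]⟩
  have ha (e : ℤˣ) (g : F) :
      (∃ (i : ℤ) (l : List (ℤˣ × ℤ)), Reduced l ∧ g = b ^ i * eval l) →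
      ∃ (i : ℤ) (l : List (ℤˣ × ℤ)), Reduced l ∧ a ^ (e : ℤ) * g = b ^ i * eval l := by
    rintro ⟨i, l, hl, rfl⟩
    by_cases hr : Reduced ((e, i) :: l)
    · exact ⟨0, _, hr, by simp [eval, mul_assoc]⟩
    · cases l with
      | nil => exact absurd (List.isChain_singleton _) hr
      | cons p l =>
        obtain ⟨e', j⟩ := p
        have h2 : i = 0 ∧ e ≠ e' := by
          by_contra hc
          refine hr (List.isChain_cons_cons.2 ⟨?_, hl⟩)
          intro h0
          by_contra h1
          exact hc ⟨h0, h1⟩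
        obtain ⟨rfl, hne⟩ := h2
        have : (e : ℤ) + e' = 0 := by
          rcases Int.units_eq_one_or e with rfl | rfl <;>
            rcases Int.units_eq_one_or e' with rfl | rfl <;> simp at hne ⊢
        refine ⟨j, l, hl.tail, ?_⟩
        simp only [eval, zpow_zero, one_mul, mul_assoc]
        rw [← mul_assoc (a ^ _), ← zpow_add, this, zpow_zero, one_mul]
  have hg : ∀ (x : Fin 2) (g : F),
      (∃ (i : ℤ) (l : List (ℤˣ × ℤ)), Reduced l ∧ g = b ^ i * eval l) → ∀ e : ℤˣ,
      ∃ (i : ℤ) (l : List (ℤˣ × ℤ)), Reduced l ∧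
        FreeGroup.of x ^ (e : ℤ) * g = b ^ i * eval l := by
    intro x g h e
    fin_cases x
    · exact ha e g h
    · exact hb e g h
  have hmem : g ∈ Subgroup.closure (Set.range (FreeGroup.of : Fin 2 → F)) := by
    rw [FreeGroup.closure_range_of]; trivial
  induction hmem using Subgroup.closure_induction_left with
  | one => exact ⟨0, [], List.isChain_nil, by simp [eval]⟩
  | mul_left x hx y hy ih =>
    obtain ⟨k, rfl⟩ := hx
    simpa using hg k y ih 1
  | inv_mul_cancel x hx y hy ih =>
    obtain ⟨k, rfl⟩ := hx
    simpa using hg k y ih (-1)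

/-- The change of the exponent following `a ^ e` when `a` is replaced by `a * b`. -/
def shift (e : ℤˣ) : ℤ := if e = 1 then 1 else 0

/-- The change of the exponent preceding a list of syllables when `a` is replaced by `a * b`. -/
def lead : List (ℤˣ × ℤ) → ℤ
  | [] => 0
  | p :: _ => if p.1 = 1 then 0 else -1

/-- The effect of `a ↦ a * b` on a list of syllables, up to a leading power of `b`. -/
def twist : List (ℤˣ × ℤ) → List (ℤˣ × ℤ)
  | [] => []
  | p :: l => (p.1, p.2 + shift p.1 + lead l) :: twist l

theorem lead_twist (l : List (ℤˣ × ℤ)) : lead (twist l) = lead l := by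
  cases l <;> rfl

theorem reduced_twist {l : List (ℤˣ × ℤ)} (hl : Reduced l) : Reduced (twist l) := by
  induction l with
  | nil => exact List.isChain_nil
  | cons p l ih =>
    cases l with
    | nil => exact List.isChain_singleton _
    | cons q l =>
      refine List.isChain_cons_cons.2 ⟨?_, ih hl.tail⟩
      have h := (List.isChain_cons_cons.1 hl).1
      simp only [shift, lead]
      intro h0
      rcases Int.units_eq_one_or p.1 with h1 | h1 <;>
        rcases Int.units_eq_one_or q.1 with h2 | h2 <;> simp_all

theorem twist_append (l l' : List (ℤˣ × ℤ)) : ∃ m, twist (l ++ l') = m ++ twist l' ∧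
    m.length = l.length := by
  induction l with
  | nil => exact ⟨[], rfl, rfl⟩
  | cons p l ih =>
    obtain ⟨m, hm, hm'⟩ := ih
    exact ⟨_ :: m, by rw [List.cons_append, twist, hm, List.cons_append], by simp [hm']⟩

theorem map_eval {ρ : MulAut F} (ha : ρ a = a * b) (hb : ρ b = b) (l : List (ℤˣ × ℤ)) :
    ρ (eval l) = b ^ lead l * eval (twist l) := by
  induction l with
  | nil => simp [eval, lead, twist]
  | cons p l ih =>
    obtain ⟨e, j⟩ := p
    rw [eval, map_mul, map_mul, map_zpow, map_zpow, ha, hb, ih]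
    rcases Int.units_eq_one_or e with rfl | rfl
    · simp only [lead, twist, eval, shift, zpow_add]
      simp only [Units.val_one, if_true, zpow_one, zpow_zero]
      group
    · simp only [lead, twist, eval, shift, zpow_add]
      simp
      group

/-- A list of syllables for `(b ^ i * eval l)⁻¹ * eval acc`, together with its leading exponent. -/
def rev : ℤ → List (ℤˣ × ℤ) → List (ℤˣ × ℤ) → ℤ × List (ℤˣ × ℤ)
  | i, [], acc => (-i, acc)
  | i, p :: l, acc => rev p.2 l ((-p.1, -i) :: acc)

theorem eval_rev (i : ℤ) (l acc : List (ℤˣ × ℤ)) :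
    b ^ (rev i l acc).1 * eval (rev i l acc).2 = (b ^ i * eval l)⁻¹ * eval acc := by
  induction l generalizing i acc with
  | nil => simp [rev, eval]
  | cons p l ih =>
    rw [rev, ih]
    simp [eval, mul_assoc]

theorem length_rev (i : ℤ) (l acc : List (ℤˣ × ℤ)) :
    (rev i l acc).2.length = l.length + acc.length := by
  induction l generalizing i acc with
  | nil => simp [rev]
  | cons p l ih => rw [rev, ih]; simp; ring

theorem suffix_rev (i : ℤ) (l acc : List (ℤˣ × ℤ)) : acc <:+ (rev i l acc).2 := by
  induction l generalizing i acc with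
  | nil => exact List.suffix_rfl
  | cons p l ih => exact (List.suffix_cons _ _).trans (ih _ _)

theorem rev_concat (i : ℤ) (l acc : List (ℤˣ × ℤ)) (e : ℤˣ) (c : ℤ) :
    ∃ m t, rev i (l ++ [(e, c)]) acc = (-c, (-e, m) :: t) := by
  induction l generalizing i acc with
  | nil => exact ⟨_, _, rfl⟩
  | cons p l ih => exact ih _ _

theorem reduced_rev {i : ℤ} {l acc : List (ℤˣ × ℤ)} (hl : Reduced l) (hacc : Reduced acc)
    (h : i = 0 → ∀ p ∈ l.head?, ∀ q ∈ acc.head?, q.1 = -p.1) : Reduced (rev i l acc).2 := by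
  induction l generalizing i acc with
  | nil => exact hacc
  | cons p l ih =>
    refine ih hl.tail (List.isChain_cons.2 ⟨?_, hacc⟩) ?_
    · intro q hq hi
      exact (h (by simpa using hi) p rfl q hq).symm
    · intro hp q hq r hr
      obtain rfl : (-p.1, -i) = r := by simpa using hr
      rw [(List.isChain_cons.1 hl).1 q hq hp]

theorem exists_conj_zpow {ρ : MulAut F} (ha : ρ a = a * b) (hb : ρ b = b)
    {l : List (ℤˣ × ℤ)} (hl : Reduced l) (k : ℤ)
    (h : ρ ((eval l)⁻¹ * b ^ k * eval (twist l)) = (eval l)⁻¹ * b ^ k * eval (twist l)) :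
    ∃ (g : F) (d m : ℤ), (eval l)⁻¹ * b ^ k * eval (twist l) = g * b ^ d * g⁻¹ ∧
      ρ g = g * b ^ m := by
  induction l generalizing k with
  | nil => exact ⟨1, k, 0, by simp [eval, twist], by simp⟩
  | cons p l ih =>
    by_cases hk : k = 0
    · have : (eval (p :: l))⁻¹ * b ^ k * eval (twist (p :: l)) =
          (eval l)⁻¹ * b ^ (shift p.1 + lead l) * eval (twist l) := by
        simp only [hk, eval, twist, zpow_add]
        group
      rw [this] at h ⊢
      exact ih hl.tail _ h
    · set L := p :: l with hL
      set V := rev (-k) L (twist L) with hV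
      have hv : (eval L)⁻¹ * b ^ k * eval (twist L) = b ^ V.1 * eval V.2 := by
        rw [eval_rev, mul_inv_rev, zpow_neg, inv_inv]
      have hVr : Reduced V.2 := reduced_rev hl (reduced_twist hl) fun h0 => by omega
      rw [hv, map_mul, map_zpow, hb, map_eval ha hb, ← mul_assoc, ← zpow_add] at h
      have htw := (eval_unique (reduced_twist hVr) hVr h).2
      obtain ⟨X, hX⟩ := suffix_rev (-k) L (twist L)
      rw [← hV] at hX
      obtain ⟨m, hm, hm'⟩ := twist_append X (twist L)
      rw [hX, htw, ← hX] at hm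
      have h2 : twist L = twist (twist L) := (List.append_inj hm hm'.symm).2
      have h3 : eval L = eval (twist L) := by
        apply ρ.injective
        rw [map_eval ha hb, map_eval ha hb, ← h2, lead_twist]
      refine ⟨(eval L)⁻¹, k, -lead L, by rw [← h3, inv_inv], ?_⟩
      rw [map_inv, map_eval ha hb, ← h3, mul_inv_rev, zpow_neg]

theorem mem_closure_of_fixed {ρ : MulAut F} (ha : ρ a = a * b) (hb : ρ b = b) {g : F}
    (hg : ρ g = g) : g ∈ Subgroup.closure {b, a * b * a⁻¹} := by
  have hbm (i : ℤ) : b ^ i ∈ Subgroup.closure {b, a * b * a⁻¹} :=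
    zpow_mem (Subgroup.subset_closure (by simp)) i
  have key : ∀ (n : ℕ) (l : List (ℤˣ × ℤ)), l.length ≤ n → twist l = l → lead l = 0 →
      eval l ∈ Subgroup.closure {b, a * b * a⁻¹} := by
    intro n
    induction n using Nat.strong_induction_on with
    | _ n ih =>
    intro l hn ht hl
    match l with
    | [] => exact one_mem _
    | [p] =>
      exfalso
      simp only [lead] at hl
      simp [twist, lead, Prod.ext_iff, shift] at ht
      simp_all
    | p :: q :: l =>
      obtain ⟨e, j⟩ := p
      obtain ⟨e', j'⟩ := q
      have he : e = 1 := by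
        by_contra hne
        simp [lead, hne] at hl
      subst he
      have he' : e' = -1 := by
        rcases Int.units_eq_one_or e' with rfl | rfl
        · simp [twist, lead, shift] at ht
        · rfl
      subst he'
      simp only [twist, shift, List.cons.injEq, Prod.mk.injEq] at ht
      obtain ⟨-, ⟨-, h1⟩, h2⟩ := ht
      have h3 : lead l = 0 := by
        rw [if_neg (by decide)] at h1
        omega
      have h4 := ih (n - 2) (by simp at hn; omega) l (by simp at hn; omega) h2 h3
      have h5 : eval ((1, j) :: (-1, j') :: l) =
          (a * b * a⁻¹) ^ j * b ^ j' * eval l := by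
        rw [conj_zpow]
        simp [eval, mul_assoc]
      rw [h5]
      exact mul_mem (mul_mem (zpow_mem (Subgroup.subset_closure (by simp)) _) (hbm _)) h4
  obtain ⟨i, l, hl, rfl⟩ := exists_reduced g
  rw [map_mul, map_zpow, hb, map_eval ha hb, ← mul_assoc, ← zpow_add] at hg
  obtain ⟨h1, h2⟩ := eval_unique (reduced_twist hl) hl hg
  exact mul_mem (hbm i) (key _ l le_rfl h2 (by omega))

theorem reduced_concat {l : List (ℤˣ × ℤ)} {e : ℤˣ} {i : ℤ} (j : ℤ)
    (h : Reduced (l ++ [(e, i)])) : Reduced (l ++ [(e, j)]) := by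
  unfold Reduced at *
  rw [List.isChain_append] at *
  refine ⟨h.1, List.isChain_singleton _, ?_⟩
  intro x hx y hy
  obtain rfl : (e, j) = y := by simpa using hy
  exact h.2.2 x hx (e, i) (by simp)

theorem eval_concat (l : List (ℤˣ × ℤ)) (e : ℤˣ) (j : ℤ) :
    eval (l ++ [(e, j)]) = eval (l ++ [(e, 0)]) * b ^ j := by
  simp [eval_append, eval, mul_assoc]

theorem exists_reduced_lift {l : List (ℤˣ × ℤ)} {e : ℤˣ} (hl : Reduced (l ++ [(e, 0)]))
    (he : ∀ p ∈ (l ++ [(e, 0)]).head?, p.1 = e) {x : List (ℤˣ × ℤ)} (hx : Reduced x) :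
    ∃ L, Reduced L ∧ FreeGroup.lift ![eval (l ++ [(e, 0)]), b] (eval x) = eval L ∧
      L.length = (l.length + 1) * x.length ∧
      L.head?.map Prod.fst = x.head?.map fun p => p.1 * e := by
  induction x with
  | nil => exact ⟨[], List.isChain_nil, by simp [eval], by simp, by simp⟩
  | cons p x ih =>
    obtain ⟨s, j⟩ := p
    obtain ⟨L, hL, hLe, hLl, hLh⟩ := ih hx.tail
    have hjoin : j = 0 → ∀ q ∈ L.head?, q.1 = s * e := by
      intro hj q hq
      rw [Option.mem_def] at hq
      rw [hq] at hLh
      cases x with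
      | nil => simp at hLh
      | cons r x =>
        have := (List.isChain_cons_cons.1 hx).1 hj
        simp only at this
        simpa [this] using hLh
    rcases Int.units_eq_one_or s with rfl | rfl
    · refine ⟨l ++ (e, j) :: L, ?_, ?_, ?_, ?_⟩
      · refine List.isChain_split.2 ⟨reduced_concat j hl, List.isChain_cons.2 ⟨?_, hL⟩⟩
        intro q hq hj
        rw [hjoin hj q hq, one_mul]
      · rw [eval, map_mul, map_mul, hLe]
        simp [eval_append, eval, mul_assoc]
      · simp [hLl]; ring
      · cases l with
        | nil => simp
        | cons r l => simpa using he r (by simp)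
    · obtain ⟨m, t, hm⟩ := rev_concat (-j) l L e 0
      refine ⟨(rev (-j) (l ++ [(e, 0)]) L).2, reduced_rev hl hL ?_, ?_, ?_, ?_⟩
      · intro hj p hp q hq
        rw [hjoin (by omega) q hq, he p hp, neg_one_mul]
      · have := eval_rev (-j) (l ++ [(e, 0)]) L
        rw [hm] at this ⊢
        rw [eval, map_mul, map_mul, hLe]
        simpa [mul_assoc] using this.symm
      · rw [length_rev, hLl]; simp; ring
      · rw [hm]; simp

theorem eq_nil_of_mem_range {l : List (ℤˣ × ℤ)} {e : ℤˣ} (hl : Reduced (l ++ [(e, 0)]))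
    (he : ∀ p ∈ (l ++ [(e, 0)]).head?, p.1 = e)
    (ha : a ∈ (FreeGroup.lift ![eval (l ++ [(e, 0)]), b]).range) : l = [] := by
  obtain ⟨x, hx⟩ := ha
  obtain ⟨i, y, hy, rfl⟩ := exists_reduced x
  obtain ⟨L, hL, hLe, hLl, -⟩ := exists_reduced_lift hl he hy
  rw [map_mul, hLe, map_zpow, FreeGroup.lift_apply_of] at hx
  have h1 : b ^ i * eval L = b ^ (0 : ℤ) * eval [(1, 0)] := by
    simpa [eval] using hx
  have h2 := (eval_unique hL (List.isChain_singleton _) h1).2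
  rw [h2] at hLl
  have := Nat.eq_one_of_mul_eq_one_right hLl.symm
  simpa using this

/-- An automorphism commuting with `ρ`, possibly composed with `a ↦ a⁻¹, b ↦ a * b⁻¹ * a⁻¹`, is
the product of a conjugation by a fixed point of `ρ` and a power of `ρ`. -/
theorem exists_form_of_commute {ρ φ : MulAut F} (ha : ρ a = a * b) (hb : ρ b = b)
    (h : Commute ρ φ) : ∃ (g : F) (k : ℤ), ρ g = g ∧
      ((φ a = g * (a * b ^ k) * g⁻¹ ∧ φ b = g * b * g⁻¹) ∨
        (φ a⁻¹ = g * (a * b ^ k) * g⁻¹ ∧ φ (a * b⁻¹ * a⁻¹) = g * b * g⁻¹)) := by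
  have hc (w : F) : ρ (φ w) = φ (ρ w) := DFunLike.congr_fun h.eq w
  have hu : ρ (φ a) = φ a * φ b := by rw [hc, ha, map_mul]
  have hv : ρ (φ b) = φ b := by rw [hc, hb]
  obtain ⟨g, d, k, hgv, hgk⟩ : ∃ (g : F) (d k : ℤ), φ b = g * b ^ d * g⁻¹ ∧
      ρ g = g * b ^ k := by
    obtain ⟨i, l, hl, hi⟩ := exists_reduced (φ a)
    have hv' : φ b = (eval l)⁻¹ * b ^ lead l * eval (twist l) := by
      rw [← inv_mul_cancel_left (φ a) (φ b), ← hu, hi, map_mul, map_zpow, hb,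
        map_eval ha hb]
      group
    have := exists_conj_zpow ha hb hl (lead l) (by rw [← hv', hv])
    rwa [← hv'] at this
  have hd : d ≠ 0 := by
    rintro rfl
    have : φ b = φ 1 := by simp [hgv]
    exact absurd (φ.injective this) (by decide)
  obtain ⟨i, l, hl, hi⟩ := exists_reduced (g⁻¹ * φ a * g)
  have hφa : φ a = g * (b ^ i * eval l) * g⁻¹ := by rw [← hi]; group
  rcases List.eq_nil_or_concat l with rfl | ⟨l, ⟨e, j⟩, rfl⟩
  · have : φ (a * b) = φ (b * a) := by
      rw [map_mul, map_mul, hφa, hgv]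
      simp only [eval, mul_one]
      group
    exact absurd (φ.injective this) (by decide)
  rw [List.concat_eq_append] at *
  have hrel : b ^ (i + lead (l ++ [(e, j)])) * eval (twist (l ++ [(e, j)])) =
      b ^ (i - k) * eval (l ++ [(e, j + (d + k))]) := by
    have h1 : ρ (g⁻¹ * φ a * g) = b ^ (-k) * (g⁻¹ * φ a * g) * b ^ (d + k) := by
      rw [map_mul, map_mul, map_inv, hgk, hu, hgv]
      group
    rw [hi, map_mul, map_zpow, hb, map_eval ha hb, eval_concat l e j] at h1
    rw [zpow_add, mul_assoc, h1, eval_concat l e (j + (d + k))]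
    group
  obtain ⟨h1, h2⟩ := eval_unique (reduced_twist hl) (reduced_concat _ hl) hrel
  have h3 : shift e = d + k := by
    obtain ⟨m, hm, hm'⟩ := twist_append l [(e, j)]
    rw [h2] at hm
    have := (List.append_inj hm hm'.symm).2
    simp [twist, lead] at this
    omega
  have hhead : k = 0 ∧ d = 1 ∧ e = 1 ∧ (∀ p ∈ (l ++ [(e, (0 : ℤ))]).head?, p.1 = e) ∨
      k = 1 ∧ d = -1 ∧ e = -1 ∧ (∀ p ∈ (l ++ [(e, (0 : ℤ))]).head?, p.1 = e) := by
    have hne : (-1 : ℤˣ) ≠ 1 := by decide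
    rcases Int.units_eq_one_or e with rfl | rfl
    · left
      cases l with
      | nil => simp [lead, shift] at h1 h3 ⊢; omega
      | cons p l =>
        rcases Int.units_eq_one_or p.1 with hp | hp <;>
          simp [lead, shift, hp, hne] at h1 h3 ⊢ <;> omega
    · right
      cases l with
      | nil => simp [lead, shift, hne] at h1 h3 ⊢; omega
      | cons p l =>
        rcases Int.units_eq_one_or p.1 with hp | hp <;>
          simp [lead, shift, hp, hne] at h1 h3 ⊢ <;> omega
  have hl0 := reduced_concat 0 hl
  have hrange : a ∈ (FreeGroup.lift ![eval (l ++ [(e, 0)]), b]).range := by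
    have hμ : (FreeGroup.lift ![eval (l ++ [(e, 0)]), b]).comp
        (FreeGroup.lift ![b ^ i * a * b ^ j, b ^ d]) =
        ((MulAut.conj g⁻¹ * φ : MulAut F) : F →* F) := by
      apply FreeGroup.ext_hom
      intro x
      fin_cases x
      · have : (MulAut.conj g⁻¹ * φ : MulAut F) a =
          b ^ i * eval (l ++ [(e, 0)]) * b ^ j := by
          rw [MulAut.mul_apply, MulAut.conj_apply, inv_inv, hi, eval_concat l e j, mul_assoc]
        simpa using this.symm
      · have : (MulAut.conj g⁻¹ * φ : MulAut F) b = b ^ d := by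
          rw [MulAut.mul_apply, MulAut.conj_apply, inv_inv, hgv]
          group
        simpa using this.symm
    refine ⟨FreeGroup.lift ![b ^ i * a * b ^ j, b ^ d] ((MulAut.conj g⁻¹ * φ)⁻¹ a), ?_⟩
    rw [← MonoidHom.comp_apply, hμ]
    exact MulAut.apply_inv_self _ _ _
  rcases hhead with ⟨rfl, rfl, rfl, hh⟩ | ⟨rfl, rfl, rfl, hh⟩
  · obtain rfl := eq_nil_of_mem_range hl0 hh hrange
    refine ⟨g * b ^ i, i + j, ?_, Or.inl ⟨?_, ?_⟩⟩
    · rw [map_mul, map_zpow, hb, hgk]; simp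
    · rw [hφa]; simp [eval]; group
    · rw [hgv]; group
  · obtain rfl := eq_nil_of_mem_range hl0 hh hrange
    refine ⟨g * b ^ i * a⁻¹, -i - j, ?_, Or.inr ⟨?_, ?_⟩⟩
    · rw [map_mul, map_mul, map_inv, map_zpow, hb, hgk, ha]; group
    · rw [map_inv, hφa]; simp [eval]; group
    · rw [map_mul, map_mul, map_inv, map_inv, hφa, hgv]; simp [eval]; group

theorem mulAut_ext {φ ψ : MulAut F} (h0 : φ a = ψ a) (h1 : φ b = ψ b) : φ = ψ := by
  have : (φ : F →* F) = ψ := by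
    apply FreeGroup.ext_hom
    intro x
    fin_cases x
    · exact h0
    · exact h1
  exact MulEquiv.ext fun w => DFunLike.congr_fun this w

/-- The involution `a ↦ a⁻¹`, `b ↦ a * b⁻¹ * a⁻¹`, as an endomorphism. -/
def flipHom : F →* F := FreeGroup.lift ![a⁻¹, a * b⁻¹ * a⁻¹]

theorem flipHom_comp_flipHom : flipHom.comp flipHom = MonoidHom.id F := by
  apply FreeGroup.ext_hom
  intro x
  fin_cases x
  · simp [flipHom]
  · simp [flipHom]

/-- The involution `a ↦ a⁻¹`, `b ↦ a * b⁻¹ * a⁻¹`. -/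
def flip : MulAut F :=
  MonoidHom.toMulEquiv flipHom flipHom flipHom_comp_flipHom flipHom_comp_flipHom

theorem flip_a : flip a = a⁻¹ := by
  change flipHom a = _
  simp [flipHom]

theorem flip_b : flip b = a * b⁻¹ * a⁻¹ := by
  change flipHom b = _
  simp [flipHom]

theorem flip_mul_flip : flip * flip = 1 :=
  MulEquiv.ext fun w => DFunLike.congr_fun flipHom_comp_flipHom w

theorem commute_flip {ρ : MulAut F} (ha : ρ a = a * b) (hb : ρ b = b) : Commute ρ flip := by
  apply mulAut_ext
  · simp [flip_a, ha, flip_b, mul_assoc]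
  · simp [flip_b, ha, hb, mul_assoc]

theorem conj_map (φ : MulAut F) (w : F) : MulAut.conj (φ w) = φ * MulAut.conj w * φ⁻¹ := by
  ext x
  simp

theorem commute_conj_b {ρ : MulAut F} (hb : ρ b = b) : Commute ρ (MulAut.conj b) := by
  have := conj_map ρ b
  rw [hb] at this
  exact (eq_mul_inv_iff_mul_eq.1 this).symm

theorem zpow_a {ρ : MulAut F} (ha : ρ a = a * b) (hb : ρ b = b) (k : ℤ) :
    (ρ ^ k) a = a * b ^ k ∧ (ρ ^ k) b = b := by
  have hbk (k : ℤ) : (ρ ^ k) b = b := by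
    have : ρ ∈ MulAction.stabilizer (MulAut F) b := hb
    exact zpow_mem this k
  refine ⟨?_, hbk k⟩
  induction k with
  | zero => simp
  | succ n ih => rw [zpow_add_one, MulAut.mul_apply, ha, map_mul, ih, hbk, zpow_add_one, mul_assoc]
  | pred n ih =>
    have hinv : ρ⁻¹ a = a * b⁻¹ := by
      have := hbk (-1)
      rw [zpow_neg_one] at this
      apply ρ.injective
      rw [MulAut.apply_inv_self, map_mul, map_inv, ha, hb, mul_inv_cancel_right]
    rw [zpow_sub_one, MulAut.mul_apply, hinv, map_mul, map_inv, ih, hbk, zpow_sub_one, mul_assoc]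

theorem mem_closure_of_commute {ρ φ : MulAut F} (ha : ρ a = a * b) (hb : ρ b = b)
    (h : Commute ρ φ) : φ ∈ Subgroup.closure {ρ, MulAut.conj b, flip} := by
  set K := Subgroup.closure {ρ, MulAut.conj b, flip} with hK
  have hρ : ρ ∈ K := Subgroup.subset_closure (by simp)
  have hcb : MulAut.conj b ∈ K := Subgroup.subset_closure (by simp)
  have hflip : flip ∈ K := Subgroup.subset_closure (by simp)
  have hconj : Subgroup.closure {b, a * b * a⁻¹} ≤ K.comap MulAut.conj := by
    rw [Subgroup.closure_le]
    rintro x (rfl | rfl)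
    · exact hcb
    · have : a * b * a⁻¹ = flip b⁻¹ := by rw [map_inv, flip_b]; group
      change MulAut.conj _ ∈ K
      rw [this, conj_map, map_inv]
      exact mul_mem (mul_mem hflip (inv_mem hcb)) (inv_mem hflip)
  obtain ⟨g, k, hg, hφ⟩ := exists_form_of_commute ha hb h
  have hgk : MulAut.conj g * ρ ^ k ∈ K :=
    mul_mem (hconj (mem_closure_of_fixed ha hb hg)) (zpow_mem hρ k)
  obtain ⟨h1, h2⟩ := zpow_a ha hb k
  rcases hφ with ⟨h3, h4⟩ | ⟨h3, h4⟩
  · have : φ = MulAut.conj g * ρ ^ k := by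
      apply mulAut_ext
      · rw [h3, MulAut.mul_apply, h1, MulAut.conj_apply]
      · rw [h4, MulAut.mul_apply, h2, MulAut.conj_apply]
    rwa [this]
  · have : φ * flip = MulAut.conj g * ρ ^ k := by
      apply mulAut_ext
      · rw [MulAut.mul_apply, flip_a, h3, MulAut.mul_apply, h1, MulAut.conj_apply]
      · rw [MulAut.mul_apply, flip_b, h4, MulAut.mul_apply, h2, MulAut.conj_apply]
    rw [← mul_inv_eq_of_eq_mul this.symm]
    exact mul_mem hgk (inv_mem hflip)

theorem zpow_ofAdd_one (m : ℤ) :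
    Multiplicative.ofAdd (1 : ℤ) ^ m = Multiplicative.ofAdd m := by
  rw [← ofAdd_zsmul, smul_eq_mul, mul_one]

/-- The exponent sum of `a`. -/
def expA : F →* Multiplicative ℤ := FreeGroup.lift ![Multiplicative.ofAdd 1, 1]

/-- The exponent sum of `b`. -/
def expB : F →* Multiplicative ℤ := FreeGroup.lift ![1, Multiplicative.ofAdd 1]

/-- The quotient map to the infinite dihedral group. -/
def toDihedral : F →* DihedralGroup 0 :=
  FreeGroup.lift ![DihedralGroup.sr 0, DihedralGroup.r 1]

/-- The automorphism of the infinite dihedral group that shifts the reflections by `m`. -/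
def reflShift (m : ℤ) : DihedralGroup 0 →* DihedralGroup 0 where
  toFun
    | .r i => .r i
    | .sr i => .sr (i + (Int.cast m : ZMod 0))
  map_one' := rfl
  map_mul' := by
    rintro (i | i) (j | j)
    · rfl
    · exact congrArg DihedralGroup.sr (sub_add_eq_add_sub j i (Int.cast m))
    · exact congrArg DihedralGroup.sr (add_right_comm i j (Int.cast m))
    · exact congrArg DihedralGroup.r (add_sub_add_right_eq_sub j i (Int.cast m)).symm

theorem reflShift_reflShift (m n : ℤ) (x : DihedralGroup 0) :
    reflShift m (reflShift n x) = reflShift (m + n) x := by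
  rcases x with i | i
  · rfl
  · change DihedralGroup.sr _ = DihedralGroup.sr _
    rw [Int.cast_add, add_comm (Int.cast m : ZMod 0), add_assoc]

theorem reflShift_zero (x : DihedralGroup 0) : reflShift 0 x = x := by
  rcases x with i | i
  · rfl
  · change DihedralGroup.sr _ = DihedralGroup.sr _
    rw [Int.cast_zero, add_zero]

/-- The sign of an element of `ZMod 2`. -/
def sgn (ε : ZMod 2) : ℤ := if ε = 0 then 1 else -1

theorem sgn_add (ε ε' : ZMod 2) : sgn (ε + ε') = sgn ε * sgn ε' := by
  revert ε ε'
  decide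

theorem sgn_neg (ε : ZMod 2) : sgn (-ε) = sgn ε := by
  revert ε
  decide

theorem sgn_mul_self (ε : ZMod 2) : sgn ε * sgn ε = 1 := by
  revert ε
  decide

theorem sgn_injective : Function.Injective sgn := by
  decide

/-- The pairs `(φ, ((k, s), ε))` such that `φ` acts on the abelianization of the free group by
`a ↦ (-1) ^ ε * (a + k * b)`, `b ↦ (-1) ^ ε * b` and on its infinite dihedral quotient by shifting
the reflections by `k - 2 * s`. -/
def graph : Subgroup (MulAut F × Multiplicative ((ℤ × ℤ) × ZMod 2)) where
  carrier := {p | ∀ w, (expA (p.1 w)).toAdd = sgn p.2.toAdd.2 * (expA w).toAdd ∧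
    (expB (p.1 w)).toAdd =
      sgn p.2.toAdd.2 * (p.2.toAdd.1.1 * (expA w).toAdd + (expB w).toAdd) ∧
    toDihedral (p.1 w) = reflShift (p.2.toAdd.1.1 - 2 * p.2.toAdd.1.2) (toDihedral w)}
  one_mem' := by
    intro w
    simp [sgn, reflShift_zero]
  mul_mem' := by
    rintro ⟨φ, t⟩ ⟨ψ, t'⟩ h h' w
    obtain ⟨h1, h2, h3⟩ := h (ψ w)
    obtain ⟨h1', h2', h3'⟩ := h' w
    simp only [Prod.mk_mul_mk, MulAut.mul_apply, toAdd_mul, Prod.fst_add, Prod.snd_add, sgn_add]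
      at *
    refine ⟨by rw [h1, h1']; ring, ?_, ?_⟩
    · rw [h2, h1', h2']; ring
    · rw [h3, h3', reflShift_reflShift]
      congr 2
      ring
  inv_mem' := by
    rintro ⟨φ, t⟩ h w
    obtain ⟨h1, h2, h3⟩ := h (φ⁻¹ w)
    simp only [Prod.inv_mk, toAdd_inv, Prod.fst_neg, Prod.snd_neg, sgn_neg,
      MulAut.apply_inv_self] at *
    have hs := sgn_mul_self t.toAdd.2
    refine ⟨?_, ?_, ?_⟩
    · linear_combination -sgn t.toAdd.2 * h1 - (expA (φ⁻¹ w)).toAdd * hs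
    · rw [h1, h2]
      linear_combination (-(t.toAdd.1.1 * (expA (φ⁻¹ w)).toAdd + (expB (φ⁻¹ w)).toAdd) +
        t.toAdd.1.1 * (expA (φ⁻¹ w)).toAdd) * hs
    · rw [h3, reflShift_reflShift]
      ring_nf
      rw [reflShift_zero]

theorem mem_graph {φ : MulAut F} {k s : ℤ} {ε : ZMod 2}
    (h1 : expA (φ a) = Multiplicative.ofAdd (sgn ε)) (h2 : expA (φ b) = 1)
    (h3 : expB (φ a) = Multiplicative.ofAdd (sgn ε * k))
    (h4 : expB (φ b) = Multiplicative.ofAdd (sgn ε))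
    (h5 : toDihedral (φ a) = reflShift (k - 2 * s) (toDihedral a))
    (h6 : toDihedral (φ b) = reflShift (k - 2 * s) (toDihedral b)) :
    (φ, Multiplicative.ofAdd ((k, s), ε)) ∈ graph := by
  have hA : expA.comp (φ : F →* F) = expA ^ sgn ε := by
    apply FreeGroup.ext_hom
    intro x
    fin_cases x
    · refine h1.trans ?_
      simp [expA, zpow_ofAdd_one]
    · refine h2.trans ?_
      simp [expA]
  have hB : expB.comp (φ : F →* F) = (expA ^ k * expB) ^ sgn ε := by
    apply FreeGroup.ext_hom
    intro x
    fin_cases x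
    · refine h3.trans ?_
      simp [expA, expB, zpow_ofAdd_one, mul_comm]
    · refine h4.trans ?_
      simp [expA, expB, zpow_ofAdd_one]
  have hD : toDihedral.comp (φ : F →* F) = (reflShift (k - 2 * s)).comp toDihedral := by
    apply FreeGroup.ext_hom
    intro x
    fin_cases x
    · exact h5
    · exact h6
  intro w
  refine ⟨?_, ?_, DFunLike.congr_fun hD w⟩
  · have := congrArg Multiplicative.toAdd (DFunLike.congr_fun hA w)
    simpa using this
  · have := congrArg Multiplicative.toAdd (DFunLike.congr_fun hB w)
    simpa using this

theorem graph_unique {φ : MulAut F} {t t' : Multiplicative ((ℤ × ℤ) × ZMod 2)}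
    (h : (φ, t) ∈ graph) (h' : (φ, t') ∈ graph) : t = t' := by
  obtain ⟨h1, h2, h3⟩ := h a
  obtain ⟨h1', h2', h3'⟩ := h' a
  have hs : t.toAdd.2 = t'.toAdd.2 := by
    apply sgn_injective
    rw [h1] at h1'
    simpa [expA] using h1'
  have hk : t.toAdd.1.1 = t'.toAdd.1.1 := by
    rw [h2] at h2'
    have h0 := sgn_mul_self t'.toAdd.2
    simp [expA, expB, hs] at h2'
    rcases h2' with h2' | h2'
    · exact h2'
    · simp [h2'] at h0
  have hm : t.toAdd.1.2 = t'.toAdd.1.2 := by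
    rw [h3] at h3'
    simp only [toDihedral, FreeGroup.lift_apply_of, Matrix.cons_val_zero] at h3'
    have := DihedralGroup.sr.inj h3'
    have h0 : t.toAdd.1.1 - 2 * t.toAdd.1.2 = t'.toAdd.1.1 - 2 * t'.toAdd.1.2 := by
      exact Int.cast_injective (α := ZMod 0) (add_left_cancel this)
    omega
  exact Multiplicative.toAdd.injective (Prod.ext (Prod.ext hk hm) hs)

theorem graph_rho {ρ : MulAut F} (ha : ρ a = a * b) (hb : ρ b = b) :
    (ρ, Multiplicative.ofAdd ((1, 0), 0)) ∈ graph := by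
  apply mem_graph <;> simp [ha, hb, expA, expB, toDihedral, sgn, reflShift]

theorem graph_conj_b :
    (MulAut.conj b, Multiplicative.ofAdd ((0, 1), 0)) ∈ graph := by
  apply mem_graph <;> simp [expA, expB, toDihedral, sgn, reflShift]
  rfl

theorem graph_flip : (flip, Multiplicative.ofAdd ((0, 0), 1)) ∈ graph := by
  apply mem_graph <;> simp [flip_a, flip_b, expA, expB, toDihedral, sgn, reflShift]

theorem exists_graph {ρ φ : MulAut F} (ha : ρ a = a * b) (hb : ρ b = b) (h : Commute ρ φ) :
    ∃ t, (φ, t) ∈ graph := by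
  have hle : Subgroup.closure {ρ, MulAut.conj b, flip} ≤ graph.map (MonoidHom.fst _ _) := by
    rw [Subgroup.closure_le]
    rintro x (rfl | rfl | rfl)
    · exact ⟨_, graph_rho ha hb, rfl⟩
    · exact ⟨_, graph_conj_b, rfl⟩
    · exact ⟨_, graph_flip, rfl⟩
  obtain ⟨⟨_, t⟩, ht, rfl⟩ := hle (mem_closure_of_commute ha hb h)
  exact ⟨t, ht⟩

theorem mem_centralizer_iff_commute {ρ φ : MulAut F} :
    φ ∈ Subgroup.centralizer {ρ} ↔ Commute ρ φ := by
  rw [Subgroup.mem_centralizer_singleton_iff]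
  exact eq_comm

theorem exists_hom {ρ : MulAut F} (ha : ρ a = a * b) (hb : ρ b = b) :
    ∃ χ : Subgroup.centralizer {ρ} →* Multiplicative ((ℤ × ℤ) × ZMod 2),
      ∀ z, (z.1, χ z) ∈ graph := by
  choose f hf using fun z : Subgroup.centralizer {ρ} =>
    exists_graph ha hb (mem_centralizer_iff_commute.1 z.2)
  exact ⟨MonoidHom.mk' f fun z z' => graph_unique (hf _) (mul_mem (hf z) (hf z')), hf⟩

/-- The class of an element of the centralizer in its abelianization. -/
abbrev centralizerClass {ρ φ : MulAut F} (h : φ ∈ Subgroup.centralizer {ρ}) :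
    Abelianization (Subgroup.centralizer {ρ}) :=
  Abelianization.of ⟨φ, h⟩

theorem exists_abelianization_eq {ρ : MulAut F} (ha : ρ a = a * b) (hb : ρ b = b)
    (hx : MulAut.conj b ∈ Subgroup.centralizer {ρ}) (hs : flip ∈ Subgroup.centralizer {ρ})
    (z : Abelianization (Subgroup.centralizer {ρ})) : ∃ k s n : ℤ,
      z = centralizerClass (mem_centralizer_self ρ) ^ k *
        centralizerClass hx ^ s * centralizerClass hs ^ n := by
  obtain ⟨⟨φ, hφ⟩, rfl⟩ := QuotientGroup.mk_surjective z
  have hmem := mem_closure_of_commute ha hb (mem_centralizer_iff_commute.1 hφ)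
  suffices ∃ (h : φ ∈ Subgroup.centralizer {ρ}) (k s n : ℤ), centralizerClass h =
      centralizerClass (mem_centralizer_self ρ) ^ k *
        centralizerClass hx ^ s * centralizerClass hs ^ n by
    obtain ⟨_, h⟩ := this
    exact h
  clear hφ
  induction hmem using Subgroup.closure_induction with
  | mem x hx =>
    rcases hx with rfl | rfl | rfl
    · exact ⟨mem_centralizer_self _, 1, 0, 0, by simp⟩
    · exact ⟨hx, 0, 1, 0, by simp⟩
    · exact ⟨hs, 0, 0, 1, by simp⟩
  | one => exact ⟨one_mem _, 0, 0, 0, rfl⟩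
  | mul x y _ _ ihx ihy =>
    obtain ⟨h, k, s, n, e⟩ := ihx
    obtain ⟨h', k', s', n', e'⟩ := ihy
    refine ⟨mul_mem h h', k + k', s + s', n + n', ?_⟩
    have hxy : centralizerClass (mul_mem h h') = centralizerClass h * centralizerClass h' := rfl
    rw [hxy, e, e', zpow_add, zpow_add, zpow_add, mul_mul_mul_comm, mul_mul_mul_comm (_ ^ k)]
  | inv x _ ihx =>
    obtain ⟨h, k, s, n, e⟩ := ihx
    refine ⟨inv_mem h, -k, -s, -n, ?_⟩
    have hinv : centralizerClass (inv_mem h) = (centralizerClass h)⁻¹ := rfl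
    rw [hinv, e, mul_inv, mul_inv, zpow_neg, zpow_neg, zpow_neg]

end NielsenCentralizer

open NielsenCentralizer in
/-- for `n = 2` (free group on `{a, b}`, with `a = of 0`, `b = of 1`),
the abelianization of the centralizer of the Nielsen automorphism
`ρ : a ↦ ab, b ↦ b` is isomorphic to `ℤ² × ℤ/2ℤ`, with `⟦ρ⟧` corresponding to
`((1,0),0)`; in particular `⟦ρ⟧` is a primitive element of the free abelian part. -/
theorem nielsen_centralizer_abelianization_n2
    (ρ : MulAut (FreeGroup (Fin 2)))
    (hρa : ρ (FreeGroup.of 0) = FreeGroup.of 0 * FreeGroup.of 1)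
    (hρ : ∀ i : Fin 2, i ≠ 0 → ρ (FreeGroup.of i) = FreeGroup.of i) :
    ∃ e : Abelianization (Subgroup.centralizer {ρ}) ≃*
        Multiplicative ((ℤ × ℤ) × ZMod 2),
      e (Abelianization.of ⟨ρ, mem_centralizer_self ρ⟩) =
        Multiplicative.ofAdd ((1, 0), 0) := by
  have hb := hρ 1 (by decide)
  obtain ⟨χ, hχ⟩ := exists_hom hρa hb
  have hx := mem_centralizer_iff_commute.2 (commute_conj_b hb)
  have hs := mem_centralizer_iff_commute.2 (commute_flip hρa hb)
  set R := centralizerClass (mem_centralizer_self ρ)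
  set X := centralizerClass hx
  set S := centralizerClass hs
  have hR : Abelianization.lift χ R = Multiplicative.ofAdd ((1, 0), 0) :=
    graph_unique (hχ _) (graph_rho hρa hb)
  have hX : Abelianization.lift χ X = Multiplicative.ofAdd ((0, 1), 0) :=
    graph_unique (hχ _) graph_conj_b
  have hS : Abelianization.lift χ S = Multiplicative.ofAdd ((0, 0), 1) :=
    graph_unique (hχ _) graph_flip
  have hval (k s n : ℤ) : Abelianization.lift χ (R ^ k * X ^ s * S ^ n) =
      Multiplicative.ofAdd ((k, s), (n : ZMod 2)) := by
    rw [map_mul, map_mul, map_zpow, map_zpow, map_zpow, hR, hX, hS]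
    simp [← ofAdd_zsmul, ← ofAdd_add]
  have hSS : S ^ (2 : ℤ) = 1 := by
    rw [zpow_ofNat, pow_two, ← map_mul, ← map_one Abelianization.of]
    exact congrArg _ (Subtype.ext flip_mul_flip)
  refine ⟨MulEquiv.ofBijective (Abelianization.lift χ) ⟨?_, ?_⟩, hR⟩
  · rw [injective_iff_map_eq_one]
    intro z hz
    obtain ⟨k, s, n, rfl⟩ := exists_abelianization_eq hρa hb hx hs z
    have h0 : ((k, s), (n : ZMod 2)) = 0 :=
      Multiplicative.ofAdd.injective ((hval k s n).symm.trans hz)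
    simp only [Prod.mk_eq_zero] at h0
    obtain ⟨⟨rfl, rfl⟩, hn⟩ := h0
    obtain ⟨m, rfl⟩ := (ZMod.intCast_zmod_eq_zero_iff_dvd n 2).1 hn
    rw [zpow_zero, zpow_zero, Nat.cast_ofNat, zpow_mul, hSS, one_zpow, mul_one, mul_one]
  · intro t
    obtain ⟨n, hn⟩ := ZMod.intCast_surjective t.toAdd.2
    exact ⟨R ^ t.toAdd.1.1 * X ^ t.toAdd.1.2 * S ^ n, by rw [hval, hn]; rfl⟩
end

section
/- Let n = 3. There is a group isomorphism from H₁(C(ρ)) onto ℤ × (ℤ/2ℤ)³ under which the class ⟦ρ⟧ corresponds to the element (2, (0,0,0)); in particular ⟦ρ⟧ has infinite order and equals twice a generator of the infinite cyclic factor. -/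
/-- The length of the longest common prefix of two lists. -/
def commonPrefixLength {β : Type*} [DecidableEq β] : List β → List β → ℕ
  | a :: l, b :: m => if a = b then commonPrefixLength l m + 1 else 0
  | _, _ => 0

section CommonPrefix

variable {β : Type*} [DecidableEq β]

theorem commonPrefixLength_comm (l m : List β) :
    commonPrefixLength l m = commonPrefixLength m l := by
  induction l generalizing m with
  | nil => cases m <;> rfl
  | cons a l ih =>
    cases m with
    | nil => rfl
    | cons b m =>
      by_cases h : a = b
      · simp [commonPrefixLength, h, ih]
      · simp [commonPrefixLength, h, Ne.symm h]

theorem min_commonPrefixLength_le (l m k : List β) :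
    min (commonPrefixLength l m) (commonPrefixLength m k) ≤ commonPrefixLength l k := by
  induction l generalizing m k with
  | nil => simp [commonPrefixLength]
  | cons a l ih =>
    rcases m with _ | ⟨b, m⟩
    · simp [commonPrefixLength]
    rcases k with _ | ⟨c, k⟩
    · simp [commonPrefixLength]
    have := ih m k
    simp only [commonPrefixLength]
    split_ifs <;> grind

theorem exists_eq_append_commonPrefixLength (l m : List β) :
    ∃ p s t : List β, l = p ++ s ∧ m = p ++ t ∧ p.length = commonPrefixLength l m ∧
      ∀ a ∈ s.head?, ∀ b ∈ t.head?, a ≠ b := by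
  induction l generalizing m with
  | nil => exact ⟨[], [], m, by simp [commonPrefixLength]⟩
  | cons a l ih =>
    rcases m with _ | ⟨b, m⟩
    · exact ⟨[], a :: l, [], by simp [commonPrefixLength]⟩
    by_cases h : a = b
    · obtain ⟨p, s, t, h1, h2, h3, h4⟩ := ih m
      exact ⟨a :: p, s, t, by simp [← h1], by simp [← h2, h], by
        simp [commonPrefixLength, h, h3], h4⟩
    · exact ⟨[], a :: l, b :: m, by simp [commonPrefixLength, h]⟩

end CommonPrefix

namespace FreeGroup

variable {α : Type*} [DecidableEq α]

/-- The Gromov product of two elements of a free group, based at the identity of the Cayley tree. -/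
def gromovProduct (u v : FreeGroup α) : ℕ := commonPrefixLength u.toWord v.toWord

theorem gromovProduct_comm (u v : FreeGroup α) : gromovProduct u v = gromovProduct v u :=
  commonPrefixLength_comm _ _

theorem min_gromovProduct_le (u v w : FreeGroup α) :
    min (gromovProduct u v) (gromovProduct v w) ≤ gromovProduct u w :=
  min_commonPrefixLength_le _ _ _

theorem norm_inv_mul (u v : FreeGroup α) :
    (u⁻¹ * v).norm + 2 * gromovProduct u v = u.norm + v.norm := by
  obtain ⟨p, s, t, hu, hv, hp, hst⟩ := exists_eq_append_commonPrefixLength u.toWord v.toWord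
  have hs : IsReduced (invRev s) := by
    have : IsReduced (p ++ s) := hu ▸ isReduced_toWord
    rw [isReduced_iff_reduce_eq, reduce_invRev]
    rw [IsReduced.reduce_eq]
    exact this.right_of_append
  have ht : IsReduced t := by
    have : IsReduced (p ++ t) := hv ▸ isReduced_toWord
    exact this.right_of_append
  have hred : IsReduced (invRev s ++ t) := by
    refine List.isChain_append.2 ⟨hs, ht, ?_⟩
    rintro ⟨x, b⟩ hx ⟨y, c⟩ hy rfl
    have hx' : (x, !b) ∈ s.head? := by
      rcases s with _ | ⟨⟨z, d⟩, s⟩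
      · simp [invRev] at hx
      · simp [invRev] at hx
        simp [hx.1, ← hx.2]
    have := hst _ hx' _ hy
    revert this
    cases b <;> cases c <;> simp
  have key : u⁻¹ * v = mk (invRev s ++ t) := by
    rw [← mk_toWord (x := u), ← mk_toWord (x := v), hu, hv, ← mul_mk, ← mul_mk, ← mul_mk,
      ← inv_mk]
    group
  have h1 : (u⁻¹ * v).norm = s.length + t.length := by
    rw [key, norm, toWord_mk, hred.reduce_eq]
    simp
  have h2 : u.norm = p.length + s.length := by rw [norm, hu]; simp
  have h3 : v.norm = p.length + t.length := by rw [norm, hv]; simp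
  rw [h1, h2, h3, gromovProduct, ← hp]
  ring

theorem norm_mul_self_gt {w : FreeGroup α} (hw : w ≠ 1) : w.norm < (w * w).norm := by
  have hconj := congrArg List.length (reduceCyclically.conj_conjugator_reduceCyclically w.toWord)
  have hsq : (w ^ 2).norm = ((reduceCyclically.conjugator w.toWord).length +
      2 * (reduceCyclically w.toWord).length) +
        (reduceCyclically.conjugator w.toWord).length := by
    rw [norm, toWord_pow, reduceCyclically.reduce_flatten_replicate isReduced_toWord]
    simp [invRev]
    ring
  have hpos : (reduceCyclically w.toWord).length ≠ 0 := by
    intro h0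
    apply hw
    rw [List.length_eq_zero_iff] at h0
    rw [← mk_toWord (x := w), ← reduceCyclically.conj_conjugator_reduceCyclically w.toWord, h0,
      ← mul_mk, ← mul_mk, ← inv_mk, ← one_eq_mk]
    group
  simp [invRev] at hconj
  rw [← pow_two, hsq, norm]
  omega

theorem two_mul_gromovProduct_inv_lt {w : FreeGroup α} (hw : w ≠ 1) :
    2 * gromovProduct w w⁻¹ < w.norm := by
  have h1 := norm_inv_mul w⁻¹ w
  have h2 := norm_mul_self_gt hw
  rw [inv_inv, norm_inv_eq, gromovProduct_comm] at h1
  omega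

theorem norm_mul_add (u v : FreeGroup α) :
    (u * v).norm + 2 * gromovProduct u⁻¹ v = u.norm + v.norm := by
  simpa using norm_inv_mul u⁻¹ v

theorem gromovProduct_self (u : FreeGroup α) : gromovProduct u u = u.norm := by
  have := norm_inv_mul u u
  simp at this
  omega

theorem norm_mul_of_norm_eq_one {l k : FreeGroup α} (hl : l.norm = 1)
    (h : k.norm ≤ (l * k).norm) : (l * k).norm = k.norm + 1 := by
  have := norm_mul_add l k
  omega

theorem norm_conj {l k : FreeGroup α} (hl : l.norm = 1) (h : k.norm ≤ (l * k).norm)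
    (h' : k.norm ≤ (l⁻¹ * k).norm) : (k⁻¹ * l * k).norm = 2 * k.norm + 1 := by
  have h1 := norm_mul_of_norm_eq_one hl h
  have h2 := norm_mul_of_norm_eq_one (by rwa [norm_inv_eq]) h'
  have h3 := norm_inv_mul (l * k) l
  have h4 := norm_inv_mul l k
  have h5 := norm_inv_mul k (l * k)
  have h6 := min_gromovProduct_le k (l * k) l
  rw [show (l * k)⁻¹ * l = k⁻¹ by group, norm_inv_eq] at h3
  rw [gromovProduct_comm l k] at h4
  rw [mul_assoc]
  omega

theorem gromovProduct_conj_inv {l k : FreeGroup α} (hl : l.norm = 1) (h : k.norm ≤ (l * k).norm)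
    (h' : k.norm ≤ (l⁻¹ * k).norm) : gromovProduct (k⁻¹ * l * k) k⁻¹ = k.norm := by
  have h1 := norm_mul_of_norm_eq_one hl h
  have h2 := norm_mul_of_norm_eq_one (by rwa [norm_inv_eq]) h'
  have h3 := norm_conj hl h h'
  have h4 := norm_inv_mul (k⁻¹ * l * k) k⁻¹
  rw [show (k⁻¹ * l * k)⁻¹ * k⁻¹ = (l * k)⁻¹ by group, norm_inv_eq, norm_inv_eq] at h4
  omega

theorem gromovProduct_conj_mul {l k : FreeGroup α} (hl : l.norm = 1) (h : k.norm ≤ (l * k).norm)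
    (h' : k.norm ≤ (l⁻¹ * k).norm) : gromovProduct (k⁻¹ * l * k) (k⁻¹ * l) = k.norm + 1 := by
  have h2 := norm_mul_of_norm_eq_one (by rwa [norm_inv_eq]) h'
  have h3 := norm_conj hl h h'
  have h4 := norm_inv_mul (k⁻¹ * l * k) (k⁻¹ * l)
  have h5 : (k⁻¹ * l).norm = (l⁻¹ * k).norm := by
    rw [← norm_inv_eq]
    group
  rw [show (k⁻¹ * l * k)⁻¹ * (k⁻¹ * l) = k⁻¹ by group, norm_inv_eq] at h4
  omega

theorem exists_zpow_mul_norm_le (a : α) (k : FreeGroup α) :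
    ∃ n : ℤ, ∀ m : ℤ, (of a ^ n * k).norm ≤ (of a ^ m * k).norm :=
  ⟨Function.argmin fun n : ℤ => (of a ^ n * k).norm, fun m =>
    Function.argmin_le (fun n : ℤ => (of a ^ n * k).norm) m⟩

/-- The centralizer of a basis element is the cyclic subgroup it generates. -/
theorem mem_zpowers_of_conj_eq {a : α} {k : FreeGroup α} (h : k⁻¹ * of a * k = of a) :
    k ∈ Subgroup.zpowers (of a) := by
  obtain ⟨n, hn⟩ := exists_zpow_mul_norm_le a k
  have h1 : (of a ^ n * k).norm ≤ (of a * (of a ^ n * k)).norm := by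
    simpa [zpow_add, mul_assoc] using hn (1 + n)
  have h2 : (of a ^ n * k).norm ≤ ((of a)⁻¹ * (of a ^ n * k)).norm := by
    simpa [zpow_add, mul_assoc] using hn (-1 + n)
  have h3 := norm_conj (norm_of a) h1 h2
  rw [show (of a ^ n * k)⁻¹ * of a * (of a ^ n * k) = k⁻¹ * of a * k by group, h,
    norm_of] at h3
  have h4 : of a ^ n * k = 1 := norm_eq_zero.1 (by omega)
  rw [eq_inv_of_mul_eq_one_right h4]
  exact inv_mem (Subgroup.zpow_mem_zpowers _ _)

theorem eq_and_mem_zpowers_of_conj_mem {a b : α} {k : FreeGroup α}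
    (h : k⁻¹ * of a * k ∈ Subgroup.zpowers (of b)) :
    a = b ∧ k ∈ Subgroup.zpowers (of b) := by
  obtain ⟨n, hn⟩ := h
  have key : ∀ f : α → Multiplicative ℤ, f b ^ n = f a := fun f => by
    simpa using congrArg (lift f) hn
  have hab : a = b := by
    by_contra hab
    have := key (fun c => if c = a then Multiplicative.ofAdd 1 else 1)
    simp only [Ne.symm hab, if_false, one_zpow, if_true] at this
    exact absurd this (by decide)
  subst hab
  have hn1 : n = 1 := by
    have := congrArg Multiplicative.toAdd (key fun _ => Multiplicative.ofAdd 1)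
    simpa using this
  refine ⟨rfl, mem_zpowers_of_conj_eq ?_⟩
  simpa [hn1] using hn.symm

section Nielsen

variable {σ : Type*} {r : σ → σ → Prop} {f : σ → FreeGroup α}

theorem length_add_le_norm_mul_prod
    (hr : ∀ s t, r s t → gromovProduct (f s)⁻¹ (f t) < (f t).norm)
    (hrr : ∀ s t u, r s t → r t u →
      gromovProduct (f s)⁻¹ (f t) + gromovProduct (f t)⁻¹ (f u) < (f t).norm)
    (L : List σ) (s : σ) (hL : (s :: L).IsChain r) (p : FreeGroup α) (n : ℕ)
    (hp : 0 < gromovProduct p⁻¹ (f s)⁻¹)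
    (hpt : ∀ t, r s t → gromovProduct (f s)⁻¹ (f t) < gromovProduct p⁻¹ (f s)⁻¹)
    (hn : n + gromovProduct p⁻¹ (f s)⁻¹ ≤ p.norm) :
    n + 1 + L.length ≤ (p * (L.map f).prod).norm := by
  induction L generalizing s p n with
  | nil => simpa using by omega
  | cons t L ih =>
    obtain ⟨hst, hL⟩ := List.isChain_cons_cons.1 hL
    have h1 := hr s t hst
    have h2 := hpt t hst
    have h3 := min_gromovProduct_le p⁻¹ (f s)⁻¹ (f t)
    have h4 := min_gromovProduct_le (f s)⁻¹ p⁻¹ (f t)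
    have h5 := norm_mul_add p (f t)
    have h6 := norm_inv_mul (p * f t)⁻¹ (f t)⁻¹
    rw [gromovProduct_comm (f s)⁻¹] at h4
    rw [show (p * f t)⁻¹⁻¹ * (f t)⁻¹ = p by group, norm_inv_eq, norm_inv_eq] at h6
    have := ih t hL (p * f t) (n + 1) (by omega)
      (fun u htu => by have := hrr s t u hst htu; omega) (by omega)
    rw [List.map_cons, List.prod_cons, ← mul_assoc, List.length_cons]
    omega

/-- Nielsen's length estimate: if every letter of a word survives cancellation with its two
neighbours, the product is at least as long as the word. -/
theorem length_le_norm_prod (hf : ∀ s, f s ≠ 1)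
    (hr : ∀ s t, r s t → gromovProduct (f s)⁻¹ (f t) < (f s).norm ∧
      gromovProduct (f s)⁻¹ (f t) < (f t).norm)
    (hrr : ∀ s t u, r s t → r t u →
      gromovProduct (f s)⁻¹ (f t) + gromovProduct (f t)⁻¹ (f u) < (f t).norm)
    (L : List σ) (hL : L.IsChain r) : L.length ≤ (L.map f).prod.norm := by
  rcases L with _ | ⟨s, L⟩
  · simp
  have h1 : 0 < (f s).norm := Nat.pos_of_ne_zero (norm_eq_zero.not.2 (hf s))
  have h2 : gromovProduct (f s)⁻¹ (f s)⁻¹ = (f s).norm := by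
    rw [gromovProduct_self, norm_inv_eq]
  have := length_add_le_norm_mul_prod (fun s t h => (hr s t h).2) hrr L s hL (f s) 0
    (by omega) (fun t ht => by rw [h2]; exact (hr s t ht).1) (by omega)
  rw [List.map_cons, List.prod_cons, List.length_cons]
  omega

end Nielsen

/-- The element or its inverse, according to a sign. -/
def signed (u : FreeGroup α) (e : Bool) : FreeGroup α := cond e u u⁻¹

omit [DecidableEq α] in
theorem signed_inv (u : FreeGroup α) (e : Bool) : (signed u e)⁻¹ = signed u (!e) := by
  cases e <;> simp [signed]

theorem signed_of_inj {a b : α} {e f : Bool} (h : signed (of a) e = signed (of b) f) :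
    a = b ∧ e = f := by
  have key : ∀ (c : α) (g : Bool), (signed (of c) g).toWord = [(c, g)] := by
    intro c g
    cases g <;> simp [signed, invRev]
  have := congrArg toWord h
  rw [key, key] at this
  simpa using this

theorem norm_signed (u : FreeGroup α) (e : Bool) : (signed u e).norm = u.norm := by
  cases e <;> simp [signed]

omit [DecidableEq α] in
theorem signed_conj (k u : FreeGroup α) (e : Bool) :
    signed (k⁻¹ * u * k) e = k⁻¹ * signed u e * k := by
  cases e <;> simp [signed, mul_assoc]

theorem two_mul_gromovProduct_signed_lt {w : FreeGroup α} (hw : w ≠ 1) (e : Bool) :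
    2 * gromovProduct (signed w e) (signed w (!e)) < w.norm := by
  cases e
  · simpa [signed, gromovProduct_comm] using two_mul_gromovProduct_inv_lt hw
  · exact two_mul_gromovProduct_inv_lt hw

/-- A pair of conjugators and an extra generator in the free group on `some false`, `some true`
and `none` which cannot be shortened by an elementary move. -/
structure IsShortTriple (k : Bool → FreeGroup (Option Bool)) (w : FreeGroup (Option Bool)) :
    Prop where
  letter_mul : ∀ i e, (k i).norm ≤ (signed (of (some i)) e * k i).norm
  mul_extra : ∀ i e, (k i).norm ≤ (k i * signed w e).norm
  mul_conj : ∀ i j, i ≠ j → ∀ e,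
    (k i).norm ≤ (k i * signed ((k j)⁻¹ * of (some j) * k j) e).norm
  conj_mul : ∀ i e f, w.norm ≤ (signed ((k i)⁻¹ * of (some i) * k i) e * signed w f).norm
  ne_one : w ≠ 1

namespace IsShortTriple

variable {k : Bool → FreeGroup (Option Bool)} {w : FreeGroup (Option Bool)}

theorem norm_letter (i e : Bool) : (signed (of (some i)) e).norm = 1 := by
  rw [norm_signed, norm_of]

theorem letter_inv_mul (h : IsShortTriple k w) (i e : Bool) :
    (k i).norm ≤ ((signed (of (some i)) e)⁻¹ * k i).norm := by
  rw [signed_inv]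
  exact h.letter_mul i _

theorem norm_conj (h : IsShortTriple k w) (i e : Bool) :
    (signed ((k i)⁻¹ * of (some i) * k i) e).norm = 2 * (k i).norm + 1 := by
  rw [signed_conj]
  exact FreeGroup.norm_conj (norm_letter i e) (h.letter_mul i e) (h.letter_inv_mul i e)

theorem gromovProduct_conj_inv (h : IsShortTriple k w) (i e : Bool) :
    gromovProduct (signed ((k i)⁻¹ * of (some i) * k i) e) (k i)⁻¹ = (k i).norm := by
  rw [signed_conj]
  exact FreeGroup.gromovProduct_conj_inv (norm_letter i e) (h.letter_mul i e)
    (h.letter_inv_mul i e)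

theorem gromovProduct_conj_mul (h : IsShortTriple k w) (i e : Bool) :
    gromovProduct (signed ((k i)⁻¹ * of (some i) * k i) e) ((k i)⁻¹ * signed (of (some i)) e) =
      (k i).norm + 1 := by
  rw [signed_conj]
  exact FreeGroup.gromovProduct_conj_mul (norm_letter i e) (h.letter_mul i e)
    (h.letter_inv_mul i e)

theorem gromovProduct_inv_conj_le (h : IsShortTriple k w) {i j : Bool} (hij : i ≠ j) (f : Bool) :
    gromovProduct (k i)⁻¹ (signed ((k j)⁻¹ * of (some j) * k j) f) ≤ (k j).norm := by
  have h1 := h.mul_conj i j hij f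
  have h2 := norm_mul_add (k i) (signed ((k j)⁻¹ * of (some j) * k j) f)
  rw [h.norm_conj j f] at h2
  omega

theorem gromovProduct_conj_conj_le (h : IsShortTriple k w) {i j : Bool} (hij : i ≠ j)
    (e f : Bool) :
    gromovProduct (signed ((k i)⁻¹ * of (some i) * k i) e)
      (signed ((k j)⁻¹ * of (some j) * k j) f) ≤ (k i).norm := by
  have hi := h.gromovProduct_conj_inv i e
  have hj := h.gromovProduct_conj_inv j f
  have hi' := h.gromovProduct_conj_mul i e
  have hj' := h.gromovProduct_conj_mul j f
  have h1 := h.gromovProduct_inv_conj_le hij f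
  have h2 := h.gromovProduct_inv_conj_le hij.symm e
  set x := signed ((k i)⁻¹ * of (some i) * k i) e
  set y := signed ((k j)⁻¹ * of (some j) * k j) f
  by_contra hlt
  have h3 := min_gromovProduct_le (k i)⁻¹ x y
  have h4 := min_gromovProduct_le (k j)⁻¹ y x
  have h5 := min_gromovProduct_le (k i)⁻¹ x (k j)⁻¹
  have h6 := min_gromovProduct_le x y (k j)⁻¹
  rw [gromovProduct_comm (k i)⁻¹ x] at h3 h5
  rw [gromovProduct_comm (k j)⁻¹ y, gromovProduct_comm y x] at h4
  have hk : k i = k j := by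
    have := norm_inv_mul (k i)⁻¹ (k j)⁻¹
    rw [norm_inv_eq, norm_inv_eq, inv_inv] at this
    exact mul_inv_eq_one.1 (norm_eq_zero.1 (by omega))
  have h7 := min_gromovProduct_le ((k i)⁻¹ * signed (of (some i)) e) x
    ((k j)⁻¹ * signed (of (some j)) f)
  have h8 := min_gromovProduct_le x y ((k j)⁻¹ * signed (of (some j)) f)
  have h9 := norm_inv_mul ((k i)⁻¹ * signed (of (some i)) e) ((k j)⁻¹ * signed (of (some j)) f)
  have h10 := norm_mul_le (k i)⁻¹ (signed (of (some i)) e)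
  have h11 := norm_mul_le (k j)⁻¹ (signed (of (some j)) f)
  rw [norm_letter, norm_inv_eq] at h10 h11
  rw [gromovProduct_comm _ x] at h7
  have h12 : (k i)⁻¹ * signed (of (some i)) e = (k j)⁻¹ * signed (of (some j)) f :=
    inv_mul_eq_one.1 (norm_eq_zero.1 (by omega))
  rw [hk, mul_right_inj] at h12
  exact hij (Option.some_injective _ (signed_of_inj h12).1)

theorem gromovProduct_conj_extra_le (h : IsShortTriple k w) (i e f : Bool) :
    gromovProduct (signed ((k i)⁻¹ * of (some i) * k i) e) (signed w f) ≤ (k i).norm := by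
  have h1 := h.conj_mul i (!e) f
  have h2 := norm_inv_mul (signed ((k i)⁻¹ * of (some i) * k i) e) (signed w f)
  rw [signed_inv, h.norm_conj, norm_signed] at h2
  omega

theorem two_mul_gromovProduct_inv_extra_le (h : IsShortTriple k w) (i f : Bool) :
    2 * gromovProduct (k i)⁻¹ (signed w f) ≤ w.norm := by
  have h1 := h.mul_extra i f
  have h2 := norm_mul_add (k i) (signed w f)
  rw [norm_signed] at h2
  omega

theorem gromovProduct_conj_extra_le_inv (h : IsShortTriple k w) (i e f : Bool) :
    gromovProduct (signed ((k i)⁻¹ * of (some i) * k i) e) (signed w f) ≤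
      gromovProduct (k i)⁻¹ (signed w f) := by
  have h1 := h.gromovProduct_conj_extra_le i e f
  have h2 := h.gromovProduct_conj_inv i e
  have h3 := min_gromovProduct_le (k i)⁻¹ (signed ((k i)⁻¹ * of (some i) * k i) e) (signed w f)
  rw [gromovProduct_comm (k i)⁻¹] at h3
  omega

end IsShortTriple

/-- The images of the basis under the endomorphism attached to a triple. -/
def tripleImage (k : Bool → FreeGroup (Option Bool)) (w : FreeGroup (Option Bool)) :
    Option Bool → FreeGroup (Option Bool)
  | none => w
  | some i => (k i)⁻¹ * of (some i) * k i

namespace IsShortTriple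

variable {k : Bool → FreeGroup (Option Bool)} {w : FreeGroup (Option Bool)}

theorem gromovProduct_conj_le (h : IsShortTriple k w) (i f : Bool) (s : Option Bool × Bool)
    (hs : s.1 = some i → s.2 = f) :
    gromovProduct (signed (tripleImage k w s.1) (!s.2)) (signed (tripleImage k w (some i)) f) ≤
      (k i).norm := by
  rcases s with ⟨_ | j, e⟩
  · rw [gromovProduct_comm]
    exact h.gromovProduct_conj_extra_le i f _
  · by_cases hij : i = j
    · subst hij
      obtain rfl : e = f := hs rfl
      have h1 := h.norm_conj i true
      have hX : (k i)⁻¹ * of (some i) * k i ≠ 1 := fun h0 => by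
        rw [h0] at h1
        simp [signed] at h1
      have h2 := two_mul_gromovProduct_signed_lt hX e
      rw [norm_signed] at h1
      rw [gromovProduct_comm]
      simp only [tripleImage]
      omega
    · rw [gromovProduct_comm]
      exact h.gromovProduct_conj_conj_le hij _ _

theorem two_mul_gromovProduct_extra_le (h : IsShortTriple k w) (f : Bool)
    (s : Option Bool × Bool) (hs : s.1 = none → s.2 = f) :
    2 * gromovProduct (signed (tripleImage k w s.1) (!s.2)) (signed w f) < w.norm ∨
      2 * gromovProduct (signed (tripleImage k w s.1) (!s.2)) (signed w f) = w.norm ∧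
      ∃ i, 2 * gromovProduct (k i)⁻¹ (signed w f) = w.norm := by
  rcases s with ⟨_ | i, e⟩
  · obtain rfl : e = f := hs rfl
    left
    rw [gromovProduct_comm]
    exact two_mul_gromovProduct_signed_lt h.ne_one e
  · have h1 := h.gromovProduct_conj_extra_le_inv i (!e) f
    have h2 := h.two_mul_gromovProduct_inv_extra_le i f
    simp only [tripleImage]
    by_cases h3 : 2 * gromovProduct (signed ((k i)⁻¹ * of (some i) * k i) (!e)) (signed w f) <
        w.norm
    · exact Or.inl h3
    · exact Or.inr ⟨by omega, i, by omega⟩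

/-- A conjugator cannot absorb half of the extra generator and half of its inverse. -/
theorem not_half_and_half (h : IsShortTriple k w) (u : FreeGroup (Option Bool)) (e : Bool) :
    ¬ (2 * gromovProduct u (signed w e) = w.norm ∧
      2 * gromovProduct u (signed w (!e)) = w.norm) := by
  rintro ⟨h1, h2⟩
  have h3 := two_mul_gromovProduct_signed_lt h.ne_one e
  have h4 := min_gromovProduct_le (signed w e) u (signed w (!e))
  rw [gromovProduct_comm _ u] at h4
  omega

theorem length_le_norm (h : IsShortTriple k w)
    (hw : ∀ i j, i ≠ j → ∀ e, ¬ (2 * gromovProduct (k i)⁻¹ (signed w e) = w.norm ∧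
      2 * gromovProduct (k j)⁻¹ (signed w (!e)) = w.norm))
    (u : FreeGroup (Option Bool)) : u.toWord.length ≤ (lift (tripleImage k w) u).norm := by
  have hw0 : 0 < w.norm := Nat.pos_of_ne_zero (norm_eq_zero.not.2 h.ne_one)
  have hnorm : ∀ i, (tripleImage k w (some i)).norm = 2 * (k i).norm + 1 := fun i => by
    rw [← norm_signed _ true]
    exact h.norm_conj i true
  have half : ∀ s t : Option Bool × Bool, (s.1 = t.1 → s.2 = t.2) →
      2 * gromovProduct (signed (tripleImage k w s.1) s.2)⁻¹
        (signed (tripleImage k w t.1) t.2) ≤ (tripleImage k w t.1).norm := by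
    rintro s ⟨_ | i, f⟩ hst
    · rw [signed_inv]
      have := h.two_mul_gromovProduct_extra_le f s hst
      simp only [tripleImage] at *
      omega
    · rw [signed_inv]
      have := h.gromovProduct_conj_le i f s hst
      have := hnorm i
      simp only at *
      omega
  have half' : ∀ s t : Option Bool × Bool, (s.1 = t.1 → s.2 = t.2) →
      2 * gromovProduct (signed (tripleImage k w s.1) s.2)⁻¹
        (signed (tripleImage k w t.1) t.2) ≤ (tripleImage k w s.1).norm := by
    intro s t hst
    have := half (t.1, !t.2) (s.1, !s.2) (fun h => by simp [hst h.symm])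
    simpa [signed_inv, gromovProduct_comm] using this
  have pos : ∀ a, 0 < (tripleImage k w a).norm := by
    rintro (_ | i)
    · exact hw0
    · rw [hnorm]
      omega
  suffices u.toWord.length ≤
      (u.toWord.map fun s => signed (tripleImage k w s.1) s.2).prod.norm by
    conv_rhs => rw [← mk_toWord (x := u), lift_mk]
    exact this
  refine length_le_norm_prod (r := fun s t : Option Bool × Bool => s.1 = t.1 → s.2 = t.2)
    ?_ ?_ ?_ _ isReduced_toWord
  · intro s hs
    have := pos s.1
    rw [← norm_signed _ s.2, hs] at this
    simp at this
  · intro s t hst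
    have h1 := half s t hst
    have h2 := half' s t hst
    have h3 := pos s.1
    have h4 := pos t.1
    simp only [norm_signed]
    omega
  · rintro s ⟨_ | i, f⟩ u hst htu
    · have h1 := h.two_mul_gromovProduct_extra_le f s hst
      have h2 := h.two_mul_gromovProduct_extra_le (!f) (u.1, !u.2)
        (fun h => by simp [← htu h.symm])
      simp only [signed_inv, norm_signed, tripleImage, Bool.not_not] at *
      rw [gromovProduct_comm (signed w !f)]
      rcases h1 with h1 | ⟨h1, i, hi⟩
      · omega
      rcases h2 with h2 | ⟨h2, j, hj⟩
      · omega
      by_cases hij : i = j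
      · subst hij
        exact absurd ⟨hi, hj⟩ (h.not_half_and_half _ f)
      · exact absurd ⟨hi, hj⟩ (hw i j hij f)
    · have h1 := h.gromovProduct_conj_le i f s hst
      have h2 := h.gromovProduct_conj_le i (!f) (u.1, !u.2)
        (fun h => by simp [← htu h.symm])
      have h3 := hnorm i
      simp only [signed_inv, norm_signed, Bool.not_not] at *
      rw [gromovProduct_comm (signed (tripleImage k w (some i)) !f)]
      omega

/-- A short triple generating the free group, without half cancellations, is trivial. -/
theorem eq_one_and_eq (h : IsShortTriple k w)
    (hw : ∀ i j, i ≠ j → ∀ e, ¬ (2 * gromovProduct (k i)⁻¹ (signed w e) = w.norm ∧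
      2 * gromovProduct (k j)⁻¹ (signed w (!e)) = w.norm))
    (hgen : Function.Surjective (lift (tripleImage k w))) :
    k = 1 ∧ (w = of none ∨ w = (of none)⁻¹) := by
  have key : ∀ a, ∃ b e, signed (tripleImage k w b) e = of a := by
    intro a
    obtain ⟨u, hu⟩ := hgen (of a)
    have h1 := h.length_le_norm hw u
    rw [hu, norm_of] at h1
    have h2 : u.toWord.length ≠ 0 := fun h0 => by
      rw [List.length_eq_zero_iff, toWord_eq_nil_iff] at h0
      rw [h0, MonoidHom.map_one] at hu
      exact one_ne_of a hu
    obtain ⟨⟨b, e⟩, hb⟩ := List.length_eq_one_iff.1 (by omega : u.toWord.length = 1)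
    refine ⟨b, e, ?_⟩
    rw [← hu, ← mk_toWord (x := u), hb, lift_mk]
    simp [signed]
  let expo (c : Option Bool) : FreeGroup (Option Bool) →* Multiplicative ℤ :=
    lift fun x => Multiplicative.ofAdd (if x = c then 1 else 0)
  have expo_signed : ∀ c u e, (expo c (signed u e)).toAdd = cond e 1 (-1) * (expo c u).toAdd := by
    intro c u e
    cases e <;> simp [signed]
  have expo_of : ∀ c a, (expo c (of a)).toAdd = if a = c then 1 else 0 := by
    intro c a
    simp [expo]
  have expo_conj : ∀ c i, (expo c (tripleImage k w (some i))).toAdd = if some i = c then 1 else 0 := by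
    intro c i
    simp [expo, tripleImage]
  have hnone : w = of none ∨ w = (of none)⁻¹ := by
    obtain ⟨_ | i, e, he⟩ := key none
    · cases e
      · exact Or.inr (inv_eq_iff_eq_inv.1 he)
      · exact Or.inl he
    · have := congrArg (fun u => (expo none u).toAdd) he
      simp [expo_signed, expo_of, expo_conj] at this
  refine ⟨funext fun i => ?_, hnone⟩
  obtain ⟨_ | j, e, he⟩ := key (some i)
  · have := congrArg (fun u => (expo (some i) u).toAdd) he
    rcases hnone with hnone | hnone <;>
      simp [expo_signed, expo_of, tripleImage, hnone] at this
  · have h1 := congrArg (fun u => (expo (some i) u).toAdd) he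
    have hij : j = i := by
      by_contra hij
      simp [expo_signed, expo_of, expo_conj, hij] at h1
    subst hij
    have h2 := h.norm_conj j e
    change (signed (tripleImage k w (some j)) e).norm = _ at h2
    rw [he, norm_of] at h2
    exact norm_eq_zero.1 (by omega)

end IsShortTriple

section Descent

variable {k : Bool → FreeGroup (Option Bool)} {w : FreeGroup (Option Bool)}

omit [DecidableEq α] in
theorem signed_mem {H : Subgroup (FreeGroup α)} {u : FreeGroup α} (hu : u ∈ H) (e : Bool) :
    signed u e ∈ H := by
  cases e
  · exact H.inv_mem hu
  · exact hu

omit [DecidableEq α] in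
theorem lift_surjective_of_mem_range {β : Type*} {t t' : β → FreeGroup α}
    (ht : Function.Surjective (lift t)) (h : ∀ b, t b ∈ (lift t').range) :
    Function.Surjective (lift t') := by
  rw [← MonoidHom.range_eq_top, eq_top_iff, ← MonoidHom.range_eq_top.2 ht, range_lift_eq_closure,
    Subgroup.closure_le]
  rintro _ ⟨b, rfl⟩
  exact h b

theorem tripleImage_mem_range (k : Bool → FreeGroup (Option Bool)) (w : FreeGroup (Option Bool))
    (b : Option Bool) : tripleImage k w b ∈ (lift (tripleImage k w)).range :=
  ⟨of b, lift_apply_of⟩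

theorem lift_tripleImage_surjective_letter (i e : Bool)
    (h : Function.Surjective (lift (tripleImage k w))) :
    Function.Surjective (lift (tripleImage (Function.update k i (signed (of (some i)) e * k i)) w)) := by
  have : tripleImage (Function.update k i (signed (of (some i)) e * k i)) w = tripleImage k w := by
    funext b
    rcases b with _ | j
    · rfl
    · by_cases hij : j = i
      · subst hij
        cases e <;> simp [tripleImage, signed, mul_assoc]
      · simp [tripleImage, hij]
  rwa [this]

theorem lift_tripleImage_surjective_mul (i : Bool) (v : FreeGroup (Option Bool))
    (hv : v ∈ (lift (tripleImage (Function.update k i (k i * v)) w)).range)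
    (h : Function.Surjective (lift (tripleImage k w))) :
    Function.Surjective (lift (tripleImage (Function.update k i (k i * v)) w)) := by
  refine lift_surjective_of_mem_range h fun b => ?_
  have hb := tripleImage_mem_range (Function.update k i (k i * v)) w b
  rcases b with _ | j
  · exact hb
  · by_cases hij : j = i
    · subst hij
      have := mul_mem (mul_mem hv hb) (inv_mem hv)
      simpa [tripleImage, mul_assoc] using this
    · simpa [tripleImage, hij] using hb

theorem lift_tripleImage_surjective_extra (i e f : Bool)
    (h : Function.Surjective (lift (tripleImage k w))) :
    Function.Surjective (lift (tripleImage k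
      (signed ((k i)⁻¹ * of (some i) * k i) e * signed w f))) := by
  refine lift_surjective_of_mem_range h fun b => ?_
  set w' := signed ((k i)⁻¹ * of (some i) * k i) e * signed w f with hw'
  have hb := tripleImage_mem_range k w'
  rcases b with _ | j
  · have h1 := mul_mem (inv_mem (signed_mem (hb (some i)) e)) (hb none)
    have h2 : signed w f ∈ (lift (tripleImage k w')).range := by
      simpa [tripleImage, hw'] using h1
    have h3 := signed_mem h2 f
    cases f <;> simpa [signed, tripleImage] using h3
  · exact hb (some j)

/-- Descent: an invariant of triples holding for the trivial triple holds for all generating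
triples. -/
theorem triple_induction (Q : (Bool → FreeGroup (Option Bool)) → FreeGroup (Option Bool) → Prop)
    (letter : ∀ k w i, Q (Function.update k i (of (some i) * k i)) w ↔ Q k w)
    (extra : ∀ k w i, Q (Function.update k i (k i * w)) w ↔ Q k w)
    (conj : ∀ k w i j, i ≠ j →
      (Q (Function.update k i (k i * ((k j)⁻¹ * of (some j) * k j))) w ↔ Q k w))
    (mul : ∀ k w i, Q k ((k i)⁻¹ * of (some i) * k i * w) ↔ Q k w)
    (inv : ∀ k w, Q k w⁻¹ ↔ Q k w) (base : Q 1 (of none))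
    (h : Function.Surjective (lift (tripleImage k w))) : Q k w := by
  have letter' : ∀ k w i e, Q (Function.update k i (signed (of (some i)) e * k i)) w ↔ Q k w := by
    intro k w i e
    cases e
    · have := letter (Function.update k i (signed (of (some i)) false * k i)) w i
      simpa [signed] using this.symm
    · exact letter k w i
  have extra' : ∀ k w i e, Q (Function.update k i (k i * signed w e)) w ↔ Q k w := by
    intro k w i e
    cases e
    · have := extra (Function.update k i (k i * signed w false)) w i
      simpa [signed] using this.symm
    · exact extra k w i
  have conj' : ∀ k w i j e, i ≠ j →
      (Q (Function.update k i (k i * signed ((k j)⁻¹ * of (some j) * k j) e)) w ↔ Q k w) := by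
    intro k w i j e hij
    cases e
    · have := conj (Function.update k i (k i * signed ((k j)⁻¹ * of (some j) * k j) false)) w i j hij
      rw [Function.update_of_ne hij.symm] at this
      simpa [signed, -mul_inv_rev] using this.symm
    · exact conj k w i j hij
  have mul' : ∀ k w i e f,
      Q k (signed ((k i)⁻¹ * of (some i) * k i) e * signed w f) ↔ Q k w := by
    intro k w i e f
    have h1 : Q k (signed w f) ↔ Q k w := by
      cases f
      · exact inv k w
      · rfl
    rw [← h1]
    cases e
    · have := mul k (signed ((k i)⁻¹ * of (some i) * k i) false * signed w f) i
      simpa [signed, -mul_inv_rev] using this.symm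
    · exact mul k _ i
  have norm_update : ∀ (k : Bool → FreeGroup (Option Bool)) i v,
      (Function.update k i v false).norm + (Function.update k i v true).norm + (k i).norm =
        (k false).norm + (k true).norm + v.norm := by
    intro k i v
    cases i <;> simp <;> omega
  induction hN : (k false).norm + (k true).norm + w.norm using Nat.strong_induction_on
    generalizing k w with
  | _ N ih =>
  by_contra hQ
  have hshort : ∀ (k' : Bool → FreeGroup (Option Bool)),
      (k' false).norm + (k' true).norm + w.norm = N →
      Function.Surjective (lift (tripleImage k' w)) → ¬ Q k' w → IsShortTriple k' w := by
    intro k' hN' hk' hQ'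
    refine ⟨fun i e => ?_, fun i e => ?_, fun i j hij e => ?_, fun i e f => ?_, ?_⟩
    · by_contra! hlt
      have := norm_update k' i (signed (of (some i)) e * k' i)
      exact hQ' ((letter' k' w i e).1
        (ih _ (by omega) (lift_tripleImage_surjective_letter i e hk') rfl))
    · by_contra! hlt
      have := norm_update k' i (k' i * signed w e)
      exact hQ' ((extra' k' w i e).1 (ih _ (by omega) (lift_tripleImage_surjective_mul i _
        (signed_mem (tripleImage_mem_range _ _ none) e) hk') rfl))
    · by_contra! hlt
      have := norm_update k' i (k' i * signed ((k' j)⁻¹ * of (some j) * k' j) e)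
      refine hQ' ((conj' k' w i j e hij).1 (ih _ (by omega) (lift_tripleImage_surjective_mul i _
        (signed_mem ?_ e) hk') rfl))
      have := tripleImage_mem_range
        (Function.update k' i (k' i * signed ((k' j)⁻¹ * of (some j) * k' j) e)) w (some j)
      simpa [tripleImage, Function.update_of_ne hij.symm] using this
    · by_contra! hlt
      exact hQ' ((mul' k' w i e f).1
        (ih _ (by omega) (lift_tripleImage_surjective_extra i e f hk') rfl))
    · rintro rfl
      obtain ⟨u, hu⟩ := hk' (of none)
      let expo : FreeGroup (Option Bool) →* Multiplicative ℤ :=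
        lift fun x => Multiplicative.ofAdd (if x = none then 1 else 0)
      have h1 : expo.comp (lift (tripleImage k' 1)) = 1 := by
        ext b
        rcases b with _ | b <;> simp [expo, tripleImage]
      have h2 := DFunLike.congr_fun h1 u
      rw [MonoidHom.comp_apply, hu] at h2
      simp [expo] at h2
  have hne := hshort k hN h hQ
  have base' : ∀ k', IsShortTriple k' w → Function.Surjective (lift (tripleImage k' w)) →
      ¬ Q k' w → ∃ i j, i ≠ j ∧ ∃ e, 2 * gromovProduct (k' i)⁻¹ (signed w e) = w.norm ∧
      2 * gromovProduct (k' j)⁻¹ (signed w (!e)) = w.norm := by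
    intro k' hk' hs hQ'
    by_contra! hw
    obtain ⟨rfl, rfl | rfl⟩ := hk'.eq_one_and_eq (fun i j hij e h => hw i j hij e h.1 h.2) hs
    · exact hQ' base
    · exact hQ' ((inv _ _).2 base)
  obtain ⟨i, j, hij, e, hi, hj⟩ := base' k hne h hQ
  set k' := Function.update k i (k i * signed w e) with hk'
  have hs' : Function.Surjective (lift (tripleImage k' w)) :=
    lift_tripleImage_surjective_mul i _ (signed_mem (tripleImage_mem_range _ _ none) e) h
  have hQ' : ¬ Q k' w := fun hq => hQ ((extra' k w i e).1 hq)
  have hnorm : (k i * signed w e).norm = (k i).norm := by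
    have := norm_inv_mul (k i)⁻¹ (signed w e)
    rw [inv_inv, norm_inv_eq, norm_signed] at this
    omega
  have hne' := hshort k' (by
    have := norm_update k i (k i * signed w e)
    rw [← hk'] at this
    omega) hs' hQ'
  have hi' : 2 * gromovProduct (k' i)⁻¹ (signed w (!e)) = w.norm := by
    have := norm_inv_mul (k' i)⁻¹ (signed w (!e))
    have h2 : (k' i)⁻¹⁻¹ * signed w (!e) = k i := by
      rw [hk', Function.update_self, ← signed_inv]
      simp
    rw [h2, hk', Function.update_self, norm_inv_eq, norm_signed, hnorm] at this
    rw [hk', Function.update_self]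
    omega
  have hj' : 2 * gromovProduct (k' j)⁻¹ (signed w (!e)) = w.norm := by
    rwa [hk', Function.update_of_ne hij.symm]
  obtain ⟨i₂, j₂, hij₂, e₂, h1, h2⟩ := base' k' hne' hs' hQ'
  have hall : ∀ l, 2 * gromovProduct (k' l)⁻¹ (signed w (!e)) = w.norm := by
    intro l
    rcases eq_or_ne l i with rfl | hl
    · exact hi'
    · obtain rfl : l = j := (Bool.eq_not.2 hl).trans (Bool.eq_not.2 hij.symm).symm
      exact hj'
  by_cases he : e₂ = !e
  · subst he
    exact hne'.not_half_and_half _ _ ⟨hall _, h2⟩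
  · obtain rfl : e₂ = e := by simpa using Bool.eq_not.2 he
    exact hne'.not_half_and_half _ _ ⟨h1, hall _⟩

end Descent

end FreeGroup

namespace NielsenCentralizer

open FreeGroup (of lift lift_apply_of signed tripleImage norm_of of_ne_one)

open HNNExtension (toSubgroup)
open HNNExtension.NormalWord (ReducedWord)

/-- The inclusion of the subgroup fixed by the Nielsen automorphism. -/
def fixedHom : FreeGroup (Option Bool) →* FreeGroup (Fin 3) :=
  lift fun
    | none => of 2
    | some true => of 1
    | some false => of 0 * (of 1)⁻¹ * (of 0)⁻¹

@[simp] theorem fixedHom_none : fixedHom (of none) = of 2 := lift_apply_of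
@[simp] theorem fixedHom_true : fixedHom (of (some true)) = of 1 := lift_apply_of
@[simp] theorem fixedHom_false :
    fixedHom (of (some false)) = of 0 * (of 1)⁻¹ * (of 0)⁻¹ := lift_apply_of

/-- The Nielsen automorphism of the free group of rank three. -/
def nielsen : MulAut (FreeGroup (Fin 3)) :=
  MonoidHom.toMulEquiv (lift ![of 0 * of 1, of 1, of 2]) (lift ![of 0 * (of 1)⁻¹, of 1, of 2])
    (by ext i; fin_cases i <;> simp) (by ext i; fin_cases i <;> simp)

@[simp] theorem nielsen_of_zero : nielsen (of 0) = of 0 * of 1 := by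
  simp [nielsen]
@[simp] theorem nielsen_of_one : nielsen (of 1) = of 1 := by
  simp [nielsen]
@[simp] theorem nielsen_of_two : nielsen (of 2) = of 2 := by
  simp [nielsen]

@[simp] theorem nielsen_fixedHom (u : FreeGroup (Option Bool)) :
    nielsen (fixedHom u) = fixedHom u := by
  have : (nielsen : FreeGroup (Fin 3) →* FreeGroup (Fin 3)).comp fixedHom = fixedHom := by
    ext b
    rcases b with _ | _ | _ <;> simp [mul_assoc]
  exact DFunLike.congr_fun this u

theorem zpowersHom_injective {α : Type*} {u : FreeGroup α} (hu : u ≠ 1) :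
    Function.Injective (zpowersHom (FreeGroup α) u) := by
  intro m n h
  simp only [zpowersHom_apply] at h
  exact Multiplicative.toAdd.injective
    (injective_zpow_iff_not_isOfFinOrder.2 (not_isOfFinOrder_of_isMulTorsionFree hu) h)

/-- The domain of the isomorphism of associated subgroups. -/
abbrev domSubgroup : Subgroup (FreeGroup (Option Bool)) :=
  (zpowersHom (FreeGroup (Option Bool)) (of (some true))).range

/-- The codomain of the isomorphism of associated subgroups. -/
abbrev codSubgroup : Subgroup (FreeGroup (Option Bool)) :=
  (zpowersHom (FreeGroup (Option Bool)) (of (some false))⁻¹).range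

/-- The isomorphism between the associated subgroups. -/
noncomputable def assocEquiv : domSubgroup ≃* codSubgroup :=
  (MonoidHom.ofInjective (zpowersHom_injective (of_ne_one _))).symm.trans
    (MonoidHom.ofInjective (zpowersHom_injective (inv_ne_one.2 (of_ne_one _))))

theorem assocEquiv_apply (n : Multiplicative ℤ) :
    (assocEquiv (MonoidHom.ofInjective (zpowersHom_injective (of_ne_one (some true))) n) :
      FreeGroup (Option Bool)) = (of (some false))⁻¹ ^ n.toAdd := by
  rw [assocEquiv, MulEquiv.trans_apply, MulEquiv.symm_apply_apply]
  rfl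

/-- The letter generating the associated subgroup with sign `e`. -/
def assocLetter (e : ℤˣ) : Option Bool := some (decide (e = 1))

theorem mem_toSubgroup_iff {e : ℤˣ} {g : FreeGroup (Option Bool)} :
    g ∈ toSubgroup domSubgroup codSubgroup e ↔ g ∈ Subgroup.zpowers (of (assocLetter e)) := by
  rcases Int.units_eq_one_or e with rfl | rfl
  · exact Iff.rfl
  · rw [← Subgroup.zpowers_inv]
    exact Iff.rfl

/-- The HNN extension decomposing the free group of rank three. -/
abbrev FreeHNN : Type :=
  HNNExtension (FreeGroup (Option Bool)) domSubgroup codSubgroup assocEquiv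

/-- The map from the HNN extension to the free group. -/
noncomputable def ofHNN : FreeHNN →* FreeGroup (Fin 3) :=
  HNNExtension.lift fixedHom (of 0) (by
    intro u
    obtain ⟨n, rfl⟩ := (MonoidHom.ofInjective
      (zpowersHom_injective (of_ne_one (some true)))).surjective u
    rw [assocEquiv_apply, map_zpow, map_inv, fixedHom_false, MonoidHom.ofInjective_apply,
      zpowersHom_apply, map_zpow, fixedHom_true]
    simp only [mul_inv_rev, inv_inv, ← mul_assoc, conj_zpow, inv_mul_cancel_right])

@[simp] theorem ofHNN_of (u : FreeGroup (Option Bool)) :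
    ofHNN (HNNExtension.of u) = fixedHom u := HNNExtension.lift_of ..

@[simp] theorem ofHNN_t : ofHNN HNNExtension.t = of 0 := HNNExtension.lift_t ..

theorem t_mul_of_true :
    (HNNExtension.t * HNNExtension.of (of (some true)) : FreeHNN) =
      HNNExtension.of (of (some false))⁻¹ * HNNExtension.t := by
  have h := HNNExtension.t_mul_of (φ := assocEquiv) (MonoidHom.ofInjective
    (zpowersHom_injective (of_ne_one (some true))) (.ofAdd 1))
  rw [assocEquiv_apply, MonoidHom.ofInjective_apply] at h
  simpa using h

/-- The inverse of `ofHNN`. -/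
noncomputable def toHNN : FreeGroup (Fin 3) →* FreeHNN :=
  lift ![HNNExtension.t, HNNExtension.of (of (some true)), HNNExtension.of (of none)]

theorem toHNN_ofHNN (u : FreeHNN) : toHNN (ofHNN u) = u := by
  have : toHNN.comp ofHNN = MonoidHom.id _ := by
    refine HNNExtension.hom_ext ?_ (by simp [toHNN])
    ext b
    rcases b with _ | _ | _
    · simp [toHNN]
    · have := t_mul_of_true
      simp only [toHNN, MonoidHom.comp_apply, ofHNN_of, fixedHom_false, map_mul, map_inv,
        lift_apply_of, Matrix.cons_val_zero, Matrix.cons_val_one, MonoidHom.id_apply]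
      rw [mul_inv_eq_iff_eq_mul, mul_inv_eq_iff_eq_mul, mul_assoc, this, ← mul_assoc, ← map_mul]
      simp
    · simp [toHNN]
  exact DFunLike.congr_fun this u

theorem ofHNN_toHNN (u : FreeGroup (Fin 3)) : ofHNN (toHNN u) = u := by
  have : ofHNN.comp toHNN = MonoidHom.id _ := by
    ext i
    fin_cases i <;> simp [toHNN]
  exact DFunLike.congr_fun this u

theorem fixedHom_injective : Function.Injective fixedHom := by
  intro u v h
  rw [← ofHNN_of, ← ofHNN_of] at h
  exact HNNExtension.of_injective _ (Function.LeftInverse.injective toHNN_ofHNN h)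

/-- The group element represented by a list of syllables. -/
noncomputable def syllableProd (l : List (ℤˣ × FreeGroup (Option Bool))) : FreeHNN :=
  (l.map fun x => HNNExtension.t ^ (x.1 : ℤ) * HNNExtension.of x.2).prod

@[simp] theorem syllableProd_nil : syllableProd [] = 1 := rfl

@[simp] theorem syllableProd_cons (x : ℤˣ × FreeGroup (Option Bool))
    (l : List (ℤˣ × FreeGroup (Option Bool))) : syllableProd (x :: l) =
      HNNExtension.t ^ (x.1 : ℤ) * HNNExtension.of x.2 * syllableProd l := by
  simp [syllableProd]

/-- The relation between consecutive syllables of a reduced word. -/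
abbrev IsReducedPair (x y : ℤˣ × FreeGroup (Option Bool)) : Prop :=
  x.2 ∈ toSubgroup domSubgroup codSubgroup x.1 → x.1 = y.1

theorem exists_syllableProd_mul {l : List (ℤˣ × FreeGroup (Option Bool))} (hl : l ≠ [])
    (hc : l.IsChain IsReducedPair) (s : FreeGroup (Option Bool)) :
    ∃ l' : List (ℤˣ × FreeGroup (Option Bool)), l'.IsChain IsReducedPair ∧
      l'.map Prod.fst = l.map Prod.fst ∧ syllableProd l' = syllableProd l * HNNExtension.of s := by
  induction l with
  | nil => exact absurd rfl hl
  | cons x l ih =>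
    rcases l with _ | ⟨y, l⟩
    · exact ⟨[(x.1, x.2 * s)], List.isChain_singleton _, rfl, by simp [mul_assoc]⟩
    · obtain ⟨l', h1, h2, h3⟩ := ih (by simp) (List.isChain_cons.1 hc).2
      refine ⟨x :: l', List.isChain_cons.2 ⟨fun y' hy' => ?_, h1⟩, by simp [h2], ?_⟩
      · have := congrArg List.head? h2
        rw [List.head?_map, Option.mem_def.1 hy'] at this
        have hy : y'.1 = y.1 := by simpa using this
        intro hx
        rw [hy]
        exact (List.isChain_cons.1 hc).1 y (by simp) hx
      · rw [syllableProd_cons, h3, syllableProd_cons x, mul_assoc, mul_assoc, mul_assoc]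

theorem exists_eq_mul_syllableProd (u : FreeHNN) :
    ∃ (g : FreeGroup (Option Bool)) (l : List (ℤˣ × FreeGroup (Option Bool))),
      l.IsChain IsReducedPair ∧ u = HNNExtension.of g * syllableProd l := by
  obtain ⟨d⟩ := HNNExtension.NormalWord.TransversalPair.nonempty
    (FreeGroup (Option Bool)) domSubgroup codSubgroup
  let w := HNNExtension.NormalWord.equiv assocEquiv d u
  refine ⟨w.head, w.toList, w.chain, ?_⟩
  exact ((HNNExtension.NormalWord.equiv assocEquiv d).symm_apply_apply u).symm

/-- The action of the Nielsen automorphism on a syllable. -/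
def twistSyllable (x : ℤˣ × FreeGroup (Option Bool)) : ℤˣ × FreeGroup (Option Bool) :=
  (x.1, of (assocLetter x.1) * x.2)

theorem twistSyllable_chain {l : List (ℤˣ × FreeGroup (Option Bool))}
    (hc : l.IsChain IsReducedPair) : (l.map twistSyllable).IsChain IsReducedPair := by
  rw [List.isChain_map]
  refine hc.imp fun x y h hx => h ?_
  have : of (assocLetter x.1) ∈ toSubgroup domSubgroup codSubgroup x.1 :=
    mem_toSubgroup_iff.2 (Subgroup.mem_zpowers _)
  exact (Subgroup.mul_mem_cancel_left _ this).1 hx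

theorem nielsen_ofHNN_syllableProd (l : List (ℤˣ × FreeGroup (Option Bool))) :
    nielsen (ofHNN (syllableProd l)) = ofHNN (syllableProd (l.map twistSyllable)) := by
  induction l with
  | nil => simp
  | cons x l ih =>
    obtain ⟨e, g⟩ := x
    rcases Int.units_eq_one_or e with rfl | rfl <;>
      simp [twistSyllable, assocLetter, ih, mul_assoc]

theorem syllableProd_ne {x : ℤˣ × FreeGroup (Option Bool)}
    {l l' : List (ℤˣ × FreeGroup (Option Bool))} (hc : (x :: l).IsChain IsReducedPair)
    (hl : l ≠ []) (hc' : l'.IsChain IsReducedPair) (hll' : l'.map Prod.fst = l.map Prod.fst) :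
    syllableProd (twistSyllable x :: l.map twistSyllable) ≠ syllableProd (x :: l') := by
  obtain ⟨y, l, rfl⟩ := List.exists_cons_of_ne_nil hl
  intro h
  rw [syllableProd_cons, syllableProd_cons, mul_assoc, mul_assoc] at h
  obtain ⟨-, h3⟩ := HNNExtension.ReducedWord.map_fst_eq_and_of_prod_eq assocEquiv
    (w₁ := ⟨(twistSyllable x).2, _, twistSyllable_chain (List.isChain_cons.1 hc).2⟩)
    (w₂ := ⟨x.2, l', hc'⟩) (mul_left_cancel h)
  have h4 := h3 y.1 (by simp [twistSyllable])
  simp only [twistSyllable, mem_toSubgroup_iff] at h4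
  rw [← inv_mem_iff] at h4
  obtain ⟨h5, h6⟩ := FreeGroup.eq_and_mem_zpowers_of_conj_mem
    (a := assocLetter x.1) (b := assocLetter (-y.1)) (k := x.2) (by simpa [mul_assoc] using h4)
  have h7 := (List.isChain_cons.1 hc).1 y (by simp) (mem_toSubgroup_iff.2 (by rwa [h5]))
  rw [h7] at h5
  rcases Int.units_eq_one_or y.1 with h | h <;> simp [h, assocLetter] at h5

theorem mem_range_or_of_nielsen_eq_mul {u : FreeGroup (Fin 3)} {s : FreeGroup (Option Bool)}
    (h : nielsen u = u * fixedHom s) :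
    (∃ g, u = fixedHom g) ∨ ∃ g k e,
      u = fixedHom g * signed (of 0) e * fixedHom k ∧ s ≠ 1 := by
  obtain ⟨g, l, hc, hu⟩ := exists_eq_mul_syllableProd (toHNN u)
  replace hu := congrArg ofHNN hu
  rw [ofHNN_toHNN] at hu
  rcases l with _ | ⟨x, l⟩
  · exact Or.inl ⟨g, by simp [hu]⟩
  have h4 : nielsen (ofHNN (syllableProd (x :: l))) =
      ofHNN (syllableProd (x :: l)) * fixedHom s := by
    rw [hu] at h
    simpa [mul_assoc] using h
  rcases eq_or_ne l [] with rfl | hl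
  · right
    obtain ⟨e, k⟩ := x
    refine ⟨g, k, decide (e = 1), ?_, ?_⟩
    · rcases Int.units_eq_one_or e with rfl | rfl <;> simp [hu, signed, mul_assoc]
    · rintro rfl
      rcases Int.units_eq_one_or e with rfl | rfl <;> simp [mul_assoc] at h4
  · obtain ⟨l', h1, h2, h3⟩ := exists_syllableProd_mul hl (List.isChain_cons.1 hc).2 s
    refine (syllableProd_ne hc hl h1 h2 ?_).elim
    rw [nielsen_ofHNN_syllableProd, ← ofHNN_of, ← map_mul] at h4
    rw [← List.map_cons, Function.LeftInverse.injective toHNN_ofHNN h4, syllableProd_cons,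
      syllableProd_cons, h3, mul_assoc, mul_assoc]

theorem nielsen_eq_self_iff {u : FreeGroup (Fin 3)} : nielsen u = u ↔ ∃ g, u = fixedHom g := by
  constructor
  · intro h
    obtain h | ⟨g, k, e, -, h⟩ := mem_range_or_of_nielsen_eq_mul (u := u) (s := 1) (by simpa using h)
    · exact h
    · exact absurd rfl h
  · rintro ⟨g, rfl⟩
    exact nielsen_fixedHom g

/-- The centralizer of the Nielsen automorphism. -/
abbrev nielsenCentralizer : Subgroup (MulAut (FreeGroup (Fin 3))) :=
  Subgroup.centralizer {nielsen}

theorem mem_nielsenCentralizer_iff {φ : MulAut (FreeGroup (Fin 3))} :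
    φ ∈ nielsenCentralizer ↔ ∀ u, nielsen (φ u) = φ (nielsen u) := by
  rw [Subgroup.mem_centralizer_iff]
  simp only [Set.mem_singleton_iff, forall_eq]
  exact DFunLike.ext_iff

theorem mem_nielsenCentralizer_of_gens {φ : MulAut (FreeGroup (Fin 3))}
    (h : ∀ i, nielsen (φ (of i)) = φ (nielsen (of i))) : φ ∈ nielsenCentralizer := by
  rw [mem_nielsenCentralizer_iff]
  have : (nielsen * φ : MulAut (FreeGroup (Fin 3))).toMonoidHom = (φ * nielsen).toMonoidHom := by
    ext i
    exact h i
  exact fun u => DFunLike.congr_fun this u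

theorem nielsen_apply_comm (φ : nielsenCentralizer) (u : FreeGroup (Fin 3)) :
    nielsen (φ.1 u) = φ.1 (nielsen u) := mem_nielsenCentralizer_iff.1 φ.2 u

theorem exists_apply_fixedHom (φ : nielsenCentralizer) (g : FreeGroup (Option Bool)) :
    ∃ h, φ.1 (fixedHom g) = fixedHom h := by
  rw [← nielsen_eq_self_iff, nielsen_apply_comm, nielsen_fixedHom]

/-- The description of an element of the centralizer by a sign, two conjugators and the image of
the last basis element. -/
def HasData (φ : nielsenCentralizer) (e : Bool) (k : Bool → FreeGroup (Option Bool))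
    (w : FreeGroup (Option Bool)) : Prop :=
  φ.1 (of 0) = (fixedHom (k false))⁻¹ * signed (of 0) e * fixedHom (k true) ∧
    φ.1 (of 2) = fixedHom w

/-- The endomorphism of the fixed subgroup induced by data. -/
def dataHom (e : Bool) (k : Bool → FreeGroup (Option Bool)) (w : FreeGroup (Option Bool)) :
    FreeGroup (Option Bool) →* FreeGroup (Option Bool) :=
  lift fun
    | none => w
    | some i => (k i)⁻¹ * of (some (i == e)) * k i

@[simp] theorem dataHom_none (e k w) : dataHom e k w (of none) = w := lift_apply_of

@[simp] theorem dataHom_some (e k w i) :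
    dataHom e k w (of (some i)) = (k i)⁻¹ * of (some (i == e)) * k i := lift_apply_of

theorem dataHom_true (k w) : dataHom true k w = lift (tripleImage k w) := by
  ext b
  rcases b with _ | i <;> simp [tripleImage]

theorem exists_hasData (φ : nielsenCentralizer) : ∃ e k w, HasData φ e k w := by
  obtain ⟨w, hw⟩ := exists_apply_fixedHom φ (of none)
  obtain ⟨s, hs⟩ := exists_apply_fixedHom φ (of (some true))
  rw [fixedHom_none] at hw
  rw [fixedHom_true] at hs
  rcases mem_range_or_of_nielsen_eq_mul (u := φ.1 (of 0)) (s := s)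
    (by rw [nielsen_apply_comm, nielsen_of_zero, map_mul, hs]) with ⟨g, hg⟩ | ⟨g, k, e, h, -⟩
  · obtain ⟨g', hg'⟩ := exists_apply_fixedHom φ⁻¹ g
    have h1 : of 0 = fixedHom g' := by
      rw [← hg', ← hg]
      exact (φ.1.symm_apply_apply _).symm
    have h2 := nielsen_fixedHom g'
    rw [← h1] at h2
    simp at h2
  · exact ⟨e, fun i => cond i k g⁻¹, w, by simpa using h, hw⟩

namespace HasData

variable {φ ψ : nielsenCentralizer} {e e' : Bool} {k k' : Bool → FreeGroup (Option Bool)}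
  {w w' : FreeGroup (Option Bool)}

theorem apply_one (h : HasData φ e k w) :
    φ.1 (of 1) = fixedHom ((k true)⁻¹ * of (some e) * k true) := by
  have h1 := nielsen_apply_comm φ (of 0)
  rw [nielsen_of_zero, map_mul, ← inv_mul_eq_iff_eq_mul] at h1
  rw [← h1, h.1]
  cases e <;> simp [signed, mul_assoc]

theorem apply_fixedHom (h : HasData φ e k w) (u : FreeGroup (Option Bool)) :
    φ.1 (fixedHom u) = fixedHom (dataHom e k w u) := by
  have : (φ.1 : FreeGroup (Fin 3) →* FreeGroup (Fin 3)).comp fixedHom =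
      fixedHom.comp (dataHom e k w) := by
    ext b
    rcases b with _ | _ | _
    · simp [h.2]
    · have h1 := h.apply_one
      have h2 := h.1
      cases e <;> simp [h1, h2, signed, mul_assoc]
    · simp [h.apply_one]
  exact DFunLike.congr_fun this u

theorem mul (h : HasData φ e k w) (h' : HasData ψ e' k' w') :
    HasData (φ * ψ) (e == e') (fun i => k (i == e') * dataHom e k w (k' i))
      (dataHom e k w w') := by
  constructor
  · change φ.1 (ψ.1 (of 0)) = _
    rw [h'.1, map_mul, map_mul, map_inv, h.apply_fixedHom, h.apply_fixedHom]
    cases e' <;> cases e <;> simp [signed, h.1, mul_assoc]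
  · change φ.1 (ψ.1 (of 2)) = _
    rw [h'.2, h.apply_fixedHom]

theorem surjective (h : HasData φ e k w) : Function.Surjective (dataHom e k w) := by
  intro u
  obtain ⟨v, hv⟩ := exists_apply_fixedHom φ⁻¹ u
  refine ⟨v, fixedHom_injective ?_⟩
  rw [← h.apply_fixedHom, ← hv]
  exact φ.1.apply_symm_apply _

theorem eq_one (h : HasData φ true 1 (of none)) : φ = 1 := by
  have h1 := h.apply_one
  have : (φ.1 : FreeGroup (Fin 3) →* FreeGroup (Fin 3)) = MonoidHom.id _ := by
    ext i
    fin_cases i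
    · simp [h.1, signed]
    · simp [h1]
    · simp [h.2]
  ext u
  exact DFunLike.congr_fun this u

end HasData

/-- The transvection multiplying the last basis element on the left by the second one. -/
def genL : nielsenCentralizer :=
  ⟨MonoidHom.toMulEquiv (lift ![of 0, of 1, of 1 * of 2]) (lift ![of 0, of 1, (of 1)⁻¹ * of 2])
    (by ext i; fin_cases i <;> simp) (by ext i; fin_cases i <;> simp),
    mem_nielsenCentralizer_of_gens fun i => by fin_cases i <;> simp⟩

/-- The involution inverting the first basis element. -/
def genSigma : nielsenCentralizer :=
  ⟨MonoidHom.toMulEquiv (lift ![(of 0)⁻¹, of 0 * (of 1)⁻¹ * (of 0)⁻¹, of 2])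
    (lift ![(of 0)⁻¹, of 0 * (of 1)⁻¹ * (of 0)⁻¹, of 2])
    (by ext i; fin_cases i <;> simp [mul_assoc]) (by ext i; fin_cases i <;> simp [mul_assoc]),
    mem_nielsenCentralizer_of_gens fun i => by fin_cases i <;> simp [mul_assoc]⟩

/-- The involution inverting the last basis element. -/
def genIota : nielsenCentralizer :=
  ⟨MonoidHom.toMulEquiv (lift ![of 0, of 1, (of 2)⁻¹]) (lift ![of 0, of 1, (of 2)⁻¹])
    (by ext i; fin_cases i <;> simp) (by ext i; fin_cases i <;> simp),
    mem_nielsenCentralizer_of_gens fun i => by fin_cases i <;> simp⟩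

/-- The automorphism multiplying the first basis element by the last one. -/
def genK : nielsenCentralizer :=
  ⟨MonoidHom.toMulEquiv (lift ![of 0 * of 2, (of 2)⁻¹ * of 1 * of 2, of 2])
    (lift ![of 0 * (of 2)⁻¹, of 2 * of 1 * (of 2)⁻¹, of 2])
    (by ext i; fin_cases i <;> simp [mul_assoc]) (by ext i; fin_cases i <;> simp [mul_assoc]),
    mem_nielsenCentralizer_of_gens fun i => by fin_cases i <;> simp [mul_assoc]⟩

/-- The Nielsen automorphism as an element of its centralizer. -/
def genRho : nielsenCentralizer := ⟨nielsen, mem_centralizer_self nielsen⟩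

theorem ext_of_gens {φ ψ : nielsenCentralizer} (h : ∀ i, φ.1 (of i) = ψ.1 (of i)) : φ = ψ := by
  have : φ.1.toMonoidHom = ψ.1.toMonoidHom := by
    ext i
    exact h i
  ext u
  exact DFunLike.congr_fun this u

theorem coe_mul_apply (φ ψ : nielsenCentralizer) (u : FreeGroup (Fin 3)) :
    (φ * ψ).1 u = φ.1 (ψ.1 u) := rfl

theorem genSigma_mul_self : genSigma * genSigma = 1 := by
  refine ext_of_gens fun i => ?_
  rw [coe_mul_apply]
  fin_cases i <;> simp [genSigma, mul_assoc]

theorem genIota_mul_self : genIota * genIota = 1 := by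
  refine ext_of_gens fun i => ?_
  rw [coe_mul_apply]
  fin_cases i <;> simp [genIota]

theorem genIota_mul_genK : genIota * genK * genIota * genK = 1 := by
  refine ext_of_gens fun i => ?_
  simp only [coe_mul_apply]
  fin_cases i <;> simp [genIota, genK, mul_assoc]

theorem genK_mul_genRho : genK * genRho = genL * genK * genIota * genL * genIota := by
  refine ext_of_gens fun i => ?_
  simp only [coe_mul_apply]
  fin_cases i <;> simp [genIota, genK, genL, genRho, mul_assoc]

/-- The subgroup generated by the four standard elements of the centralizer. -/
def genSubgroup : Subgroup nielsenCentralizer :=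
  Subgroup.closure {genL, genSigma, genIota, genK}

theorem genL_mem : genL ∈ genSubgroup := Subgroup.subset_closure (by simp)
theorem genSigma_mem : genSigma ∈ genSubgroup := Subgroup.subset_closure (by simp)
theorem genIota_mem : genIota ∈ genSubgroup := Subgroup.subset_closure (by simp)
theorem genK_mem : genK ∈ genSubgroup := Subgroup.subset_closure (by simp)

theorem genRho_mem : genRho ∈ genSubgroup := by
  rw [← inv_mul_cancel_left genK genRho, genK_mul_genRho]
  exact mul_mem (inv_mem genK_mem) (mul_mem (mul_mem (mul_mem (mul_mem genL_mem genK_mem)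
    genIota_mem) genL_mem) genIota_mem)

theorem genIota_inv : genIota⁻¹ = genIota := inv_eq_of_mul_eq_one_left genIota_mul_self

theorem exists_letter_mem (i : Bool) : ∃ g ∈ genSubgroup,
    HasData g true (Function.update 1 i (of (some i))) (of none) ∧
      HasData g⁻¹ true (Function.update 1 i (of (some i))⁻¹) (of none) := by
  refine ⟨genRho, genRho_mem, ⟨?_, ?_⟩, ⟨?_, ?_⟩⟩ <;> cases i <;>
    simp [genRho, signed, MulEquiv.symm_apply_eq, mul_assoc]

theorem exists_extra_mem (i : Bool) : ∃ g ∈ genSubgroup,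
    HasData g true (Function.update 1 i (of none)) (of none) ∧
      HasData g⁻¹ true (Function.update 1 i (of none)⁻¹) (of none) := by
  cases i
  · refine ⟨genSigma * genK * genSigma,
      mul_mem (mul_mem genSigma_mem genK_mem) genSigma_mem, ⟨?_, ?_⟩, ⟨?_, ?_⟩⟩ <;>
    simp [genK, genSigma, signed, mul_assoc]
  · refine ⟨genK, genK_mem, ⟨?_, ?_⟩, ⟨?_, ?_⟩⟩ <;>
    simp [genK, signed]

theorem exists_mul_mem (i : Bool) : ∃ g ∈ genSubgroup,
    HasData g true 1 (of (some i) * of none) ∧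
      HasData g⁻¹ true 1 ((of (some i))⁻¹ * of none) := by
  cases i
  · refine ⟨genSigma * genL * genSigma,
      mul_mem (mul_mem genSigma_mem genL_mem) genSigma_mem, ⟨?_, ?_⟩, ⟨?_, ?_⟩⟩ <;>
    simp [genL, genSigma, signed, mul_assoc]
  · refine ⟨genL, genL_mem, ⟨?_, ?_⟩, ⟨?_, ?_⟩⟩ <;>
    simp [genL, signed]

theorem hasData_genIota : HasData genIota true 1 (of none)⁻¹ := by
  constructor <;> simp [genIota, signed]

theorem exists_conj_mem (i : Bool) : ∃ g ∈ genSubgroup,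
    HasData g true (Function.update 1 i (of (some !i))) (of none) ∧
      HasData g⁻¹ true (Function.update 1 i (of (some !i))⁻¹) (of none) := by
  have h1 : genSigma * genL * genSigma * genK * (genSigma * genL⁻¹ * genSigma) * genK⁻¹ ∈
      genSubgroup :=
    mul_mem (mul_mem (mul_mem (mul_mem (mul_mem genSigma_mem genL_mem) genSigma_mem) genK_mem)
      (mul_mem (mul_mem genSigma_mem (inv_mem genL_mem)) genSigma_mem)) (inv_mem genK_mem)
  cases i
  · refine ⟨_, mul_mem (mul_mem genSigma_mem h1) genSigma_mem, ⟨?_, ?_⟩, ⟨?_, ?_⟩⟩ <;>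
    simp [genL, genK, genSigma, signed, mul_assoc]
  · refine ⟨_, h1, ⟨?_, ?_⟩, ⟨?_, ?_⟩⟩ <;>
    simp [genL, genK, genSigma, signed, mul_assoc]

theorem forall_hasData_mem_iff {g : nielsenCentralizer} (hg : g ∈ genSubgroup)
    {κ κ' k k' : Bool → FreeGroup (Option Bool)} {ω ω' w w' : FreeGroup (Option Bool)}
    (hd : HasData g true κ ω) (hd' : HasData g⁻¹ true κ' ω')
    (hk : ∀ i, k i * dataHom true k w (κ i) = k' i) (hw : dataHom true k w ω = w')
    (hk' : ∀ i, k' i * dataHom true k' w' (κ' i) = k i) (hw' : dataHom true k' w' ω' = w) :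
    (∀ φ, HasData φ true k' w' → φ ∈ genSubgroup) ↔ ∀ φ, HasData φ true k w → φ ∈ genSubgroup := by
  constructor
  · intro h φ hφ
    have h1 := hφ.mul hd
    simp only [beq_true, hk, hw] at h1
    exact (Subgroup.mul_mem_cancel_right _ hg).1 (h _ h1)
  · intro h φ hφ
    have h1 := hφ.mul hd'
    simp only [beq_true, hk', hw'] at h1
    exact (Subgroup.mul_mem_cancel_right _ (inv_mem hg)).1 (h _ h1)

theorem HasData.mem_genSubgroup {φ : nielsenCentralizer} {k : Bool → FreeGroup (Option Bool)}
    {w : FreeGroup (Option Bool)} (h : HasData φ true k w) : φ ∈ genSubgroup := by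
  refine FreeGroup.triple_induction (fun k w => ∀ φ, HasData φ true k w → φ ∈ genSubgroup)
    ?_ ?_ ?_ ?_ ?_ ?_ (dataHom_true k w ▸ h.surjective) φ h
  · intro k w i
    obtain ⟨g, hg, hd, hd'⟩ := exists_letter_mem i
    refine forall_hasData_mem_iff hg hd hd' (fun j => ?_) (by simp) (fun j => ?_) (by simp)
    · by_cases hj : j = i <;> simp [hj, mul_assoc]
    · by_cases hj : j = i <;> simp [hj, mul_assoc]
  · intro k w i
    obtain ⟨g, hg, hd, hd'⟩ := exists_extra_mem i
    refine forall_hasData_mem_iff hg hd hd' (fun j => ?_) (by simp) (fun j => ?_) (by simp)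
    · by_cases hj : j = i <;> simp [hj]
    · by_cases hj : j = i <;> simp [hj]
  · intro k w i j hij
    obtain rfl : j = !i := Bool.eq_not.2 hij.symm
    obtain ⟨g, hg, hd, hd'⟩ := exists_conj_mem i
    refine forall_hasData_mem_iff hg hd hd' (fun j => ?_) (by simp) (fun j => ?_) (by simp)
    · by_cases hj : j = i <;> simp [hj, mul_assoc]
    · by_cases hj : j = i <;> simp [hj, mul_assoc]
  · intro k w i
    obtain ⟨g, hg, hd, hd'⟩ := exists_mul_mem i
    refine forall_hasData_mem_iff hg hd hd' (fun j => ?_) ?_ (fun j => ?_) ?_ <;>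
      simp [mul_assoc]
  · intro k w
    refine forall_hasData_mem_iff genIota_mem hasData_genIota (genIota_inv ▸ hasData_genIota)
      (fun j => ?_) ?_ (fun j => ?_) ?_ <;> simp
  · intro φ h
    rw [h.eq_one]
    exact one_mem _

theorem hasData_genSigma : HasData genSigma false 1 (of none) := by
  constructor <;> simp [genSigma, signed]

theorem genSubgroup_eq_top : genSubgroup = ⊤ := by
  rw [eq_top_iff]
  intro φ _
  obtain ⟨e, k, w, h⟩ := exists_hasData φ
  cases e
  · rw [← Subgroup.mul_mem_cancel_right _ genSigma_mem]
    exact (h.mul hasData_genSigma).mem_genSubgroup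
  · exact h.mem_genSubgroup

/-- The exponent sum of the extra generator. -/
def extraExp (u : FreeGroup (Option Bool)) : ℤ :=
  (lift (fun x => Multiplicative.ofAdd (if x = none then (1 : ℤ) else 0)) u).toAdd

@[simp] theorem extraExp_one : extraExp 1 = 0 := by simp [extraExp]
@[simp] theorem extraExp_mul (u v) : extraExp (u * v) = extraExp u + extraExp v := by
  simp [extraExp]
@[simp] theorem extraExp_inv (u) : extraExp u⁻¹ = -extraExp u := by simp [extraExp]
@[simp] theorem extraExp_of_none : extraExp (of none) = 1 := by simp [extraExp]
@[simp] theorem extraExp_of_some (i) : extraExp (of (some i)) = 0 := by simp [extraExp]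
@[simp] theorem extraExp_zpow (u) (n : ℤ) : extraExp (u ^ n) = n * extraExp u := by
  simp [extraExp]

theorem extraExp_dataHom (e k w u) :
    extraExp (dataHom e k w u) = extraExp w * extraExp u := by
  induction u using FreeGroup.induction_on with
  | C1 => simp
  | of x => rcases x with _ | i <;> simp
  | inv_of x ih => simp [ih]
  | mul u v hu hv => simp [hu, hv, mul_add]

/-- The sign character sending the extra generator to `-1`. -/
def extraSign (u : FreeGroup (Option Bool)) : ℤ := ((-1 : ℤˣ) ^ extraExp u : ℤˣ)

@[simp] theorem extraSign_one : extraSign 1 = 1 := by simp [extraSign]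
@[simp] theorem extraSign_mul (u v) : extraSign (u * v) = extraSign u * extraSign v := by
  simp [extraSign, zpow_add]
theorem extraSign_mul_self (u) : extraSign u * extraSign u = 1 := by
  rw [extraSign, ← Units.val_mul, Int.units_mul_self, Units.val_one]
@[simp] theorem extraSign_inv (u) : extraSign u⁻¹ = extraSign u := by
  simp [extraSign]
@[simp] theorem extraSign_of_none : extraSign (of none) = -1 := by simp [extraSign]
@[simp] theorem extraSign_of_some (i) : extraSign (of (some i)) = 1 := by simp [extraSign]

/-- The affine action on the integers in which the letter `i` is a translation and the extra
generator is a reflection. -/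
def affineAction (i : Bool) : FreeGroup (Option Bool) →* Equiv.Perm ℤ :=
  lift fun
    | none => Equiv.neg ℤ
    | some j => if j = i then Equiv.addRight 1 else 1

/-- The twisted exponent sum of the letter `i`. -/
def twistedExp (i : Bool) (u : FreeGroup (Option Bool)) : ℤ := affineAction i u 0

theorem affineAction_apply (i : Bool) (u : FreeGroup (Option Bool)) (t : ℤ) :
    affineAction i u t = extraSign u * t + twistedExp i u := by
  induction u using FreeGroup.induction_on generalizing t with
  | C1 => simp [twistedExp]
  | of x =>
    rcases x with _ | j
    · simp [twistedExp, affineAction]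
    · by_cases hj : j = i <;> simp [twistedExp, affineAction, hj]
  | inv_of x ih =>
    rcases x with _ | j
    · simp [twistedExp, affineAction, Equiv.Perm.inv_def]
    · by_cases hj : j = i <;> simp [twistedExp, affineAction, hj, Equiv.Perm.inv_def]
  | mul u v hu hv =>
    simp only [twistedExp, map_mul, Equiv.Perm.mul_apply] at *
    rw [hv, hu, hu (affineAction i v 0), extraSign_mul]
    ring

@[simp] theorem twistedExp_one (i) : twistedExp i 1 = 0 := by simp [twistedExp]
@[simp] theorem twistedExp_mul (i u v) :
    twistedExp i (u * v) = twistedExp i u + extraSign u * twistedExp i v := by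
  rw [twistedExp, map_mul, Equiv.Perm.mul_apply, affineAction_apply, add_comm]
  rfl
@[simp] theorem twistedExp_inv (i u) : twistedExp i u⁻¹ = -(extraSign u * twistedExp i u) := by
  have h := twistedExp_mul i u⁻¹ u
  rw [inv_mul_cancel, twistedExp_one, extraSign_inv] at h
  linarith
@[simp] theorem twistedExp_of_none (i) : twistedExp i (of none) = 0 := by
  simp [twistedExp, affineAction]
@[simp] theorem twistedExp_of_some (i j) :
    twistedExp i (of (some j)) = if j = i then 1 else 0 := by
  by_cases h : j = i <;> simp [twistedExp, affineAction, h]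

theorem extraSign_dataHom {w : FreeGroup (Option Bool)} (hw : IsUnit (extraExp w)) (e k u) :
    extraSign (dataHom e k w u) = extraSign u := by
  rw [extraSign, extraExp_dataHom]
  rcases Int.isUnit_iff.1 hw with h | h <;> simp [h, extraSign]

theorem extraSign_of_isUnit {w : FreeGroup (Option Bool)} (hw : IsUnit (extraExp w)) :
    extraSign w = -1 := by
  rw [extraSign]
  rcases Int.isUnit_iff.1 hw with h | h <;> simp [h]

theorem two_mul_twistedExp_dataHom {w : FreeGroup (Option Bool)} (hw : IsUnit (extraExp w))
    (e k u i) : 2 * twistedExp (i == e) (dataHom e k w u) =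
      2 * (extraSign (k i) * twistedExp i u) + (1 - extraSign u) * twistedExp (i == e) w := by
  have inv_step : ∀ u, 2 * twistedExp (i == e) (dataHom e k w u) =
      2 * (extraSign (k i) * twistedExp i u) + (1 - extraSign u) * twistedExp (i == e) w →
      2 * twistedExp (i == e) (dataHom e k w u⁻¹) =
      2 * (extraSign (k i) * twistedExp i u⁻¹) +
        (1 - extraSign u⁻¹) * twistedExp (i == e) w := by
    intro u h
    rw [map_inv, twistedExp_inv, twistedExp_inv, extraSign_inv, extraSign_dataHom hw]
    linear_combination (-extraSign u) * h + twistedExp (i == e) w * extraSign_mul_self u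
  have of_step : ∀ x, 2 * twistedExp (i == e) (dataHom e k w (of x)) =
      2 * (extraSign (k i) * twistedExp i (of x)) +
        (1 - extraSign (of x)) * twistedExp (i == e) w := by
    rintro (_ | j)
    · simp
    · by_cases hj : j = i
      · subst hj
        simp
      · have : (j == e) ≠ (i == e) := by
          cases i <;> cases j <;> cases e <;> simp_all
        simp [hj, this]
  induction u using FreeGroup.induction_on with
  | C1 => simp
  | of x => exact of_step x
  | inv_of x _ => exact inv_step _ (of_step x)
  | mul u v hu hv =>
    rw [map_mul, twistedExp_mul, twistedExp_mul, extraSign_mul, extraSign_dataHom hw]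
    linear_combination hu + extraSign u * hv

theorem HasData.isUnit_extraExp {φ : nielsenCentralizer} {e : Bool}
    {k : Bool → FreeGroup (Option Bool)} {w : FreeGroup (Option Bool)} (h : HasData φ e k w) :
    IsUnit (extraExp w) := by
  obtain ⟨u, hu⟩ := h.surjective (of none)
  have h1 := extraExp_dataHom e k w u
  rw [hu, extraExp_of_none] at h1
  exact IsUnit.of_mul_eq_one _ h1.symm

/-- The contribution of one conjugator to the infinite order invariant. -/
def fluxAt (e : Bool) (k : Bool → FreeGroup (Option Bool)) (w : FreeGroup (Option Bool))
    (i : Bool) : ℤ :=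
  2 * twistedExp (i == e) (k i) + extraSign (k i) * twistedExp (i == e) w

theorem fluxAt_mul {w w' : FreeGroup (Option Bool)} (hw : IsUnit (extraExp w))
    (hw' : IsUnit (extraExp w')) (e e' : Bool) (k k' : Bool → FreeGroup (Option Bool)) (i : Bool) :
    fluxAt (e == e') (fun i => k (i == e') * dataHom e k w (k' i)) (dataHom e k w w') i =
      fluxAt e k w (i == e') + fluxAt e' k' w' i := by
  have hi : (i == (e == e')) = ((i == e') == e) := by
    cases i <;> cases e <;> cases e' <;> rfl
  have hk := two_mul_twistedExp_dataHom hw e k (k' i) (i == e')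
  have hww := two_mul_twistedExp_dataHom hw e k w' (i == e')
  rw [extraSign_of_isUnit hw'] at hww
  simp only [fluxAt, hi, twistedExp_mul, extraSign_mul, extraSign_dataHom hw]
  have hs := extraSign_mul_self (k (i == e'))
  have hww' : twistedExp ((i == e') == e) (dataHom e k w w') =
      extraSign (k (i == e')) * twistedExp (i == e') w' + twistedExp ((i == e') == e) w := by
    linarith
  rw [hww']
  linear_combination extraSign (k (i == e')) * hk +
    (2 * twistedExp (i == e') (k' i) + extraSign (k' i) * twistedExp (i == e') w') * hs

/-- The value of the abelianization invariant on data. -/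
def dataValue (e : Bool) (k : Bool → FreeGroup (Option Bool)) (w : FreeGroup (Option Bool)) :
    ℤ × (ZMod 2 × ZMod 2 × ZMod 2) :=
  (fluxAt e k w false + fluxAt e k w true, if e then 0 else 1, if extraExp w = 1 then 0 else 1,
    ((extraExp (k false) + extraExp (k true) : ℤ) : ZMod 2))

theorem dataValue_mul {w w' : FreeGroup (Option Bool)} (hw : IsUnit (extraExp w))
    (hw' : IsUnit (extraExp w')) (e e' : Bool) (k k' : Bool → FreeGroup (Option Bool)) :
    dataValue (e == e') (fun i => k (i == e') * dataHom e k w (k' i)) (dataHom e k w w') =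
      dataValue e k w + dataValue e' k' w' := by
  have h2 : (-1 : ZMod 2) = 1 := rfl
  have h3 : (1 + 1 : ZMod 2) = 0 := rfl
  refine Prod.ext ?_ (Prod.ext ?_ (Prod.ext ?_ ?_))
  · simp only [dataValue, fluxAt_mul hw hw', Prod.fst_add]
    cases e'
    · change fluxAt e k w true + _ + (fluxAt e k w false + _) = _
      ring
    · change fluxAt e k w false + _ + (fluxAt e k w true + _) = _
      ring
  · cases e <;> cases e' <;> simp [dataValue, h3]
  · rcases Int.isUnit_iff.1 hw with h | h <;> rcases Int.isUnit_iff.1 hw' with h' | h' <;>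
      simp [dataValue, extraExp_dataHom, h, h', h3]
  · have h1 : ((extraExp w : ℤ) : ZMod 2) = 1 := by
      rcases Int.isUnit_iff.1 hw with h | h <;> simp [h, h2]
    cases e' <;> simp [dataValue, extraExp_dataHom, h1] <;> ring

theorem extraSign_of_some_zpow (j : Bool) (n : ℤ) : extraSign (of (some j) ^ n) = 1 := by
  rw [extraSign, extraExp_zpow, extraExp_of_some, mul_zero, zpow_zero, Units.val_one]

theorem twistedExp_of_some_zpow (i j : Bool) (n : ℤ) :
    twistedExp i (of (some j) ^ n) = if j = i then n else 0 := by
  induction n with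
  | zero => simp
  | succ n ih =>
    rw [zpow_add_one, twistedExp_mul, ih, twistedExp_of_some, extraSign_of_some_zpow]
    by_cases h : j = i <;> simp [h]
  | pred n ih =>
    rw [zpow_sub_one, twistedExp_mul, ih, twistedExp_inv, twistedExp_of_some,
      extraSign_of_some_zpow]
    by_cases h : j = i <;> simp [h, sub_eq_add_neg]

/-- The exponent sum of the first basis element. -/
def stableExp : FreeGroup (Fin 3) →* Multiplicative ℤ :=
  lift (Pi.mulSingle 0 (Multiplicative.ofAdd 1))

theorem stableExp_fixedHom (u : FreeGroup (Option Bool)) : stableExp (fixedHom u) = 1 := by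
  have : stableExp.comp fixedHom = 1 := by
    ext b
    rcases b with _ | _ | _ <;> simp [stableExp]
  exact DFunLike.congr_fun this u

theorem HasData.dataValue_one {e : Bool} {k : Bool → FreeGroup (Option Bool)}
    {w : FreeGroup (Option Bool)} (h : HasData 1 e k w) : dataValue e k w = 0 := by
  have h0 := h.1
  have hz := h.apply_one
  have hw := h.2
  simp only [OneMemClass.coe_one, MulAut.one_apply] at h0 hz hw
  obtain rfl : e = true := by
    cases e
    · have h1 := congrArg stableExp h0
      rw [map_mul, map_mul, map_inv, stableExp_fixedHom, stableExp_fixedHom] at h1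
      have h2 := congrArg Multiplicative.toAdd h1
      simp [signed, stableExp] at h2
    · rfl
  obtain rfl : of none = w := fixedHom_injective (by rw [← hw, fixedHom_none])
  obtain ⟨n, hn⟩ := Subgroup.mem_zpowers_iff.1 (FreeGroup.mem_zpowers_of_conj_eq
    (fixedHom_injective (by rw [← hz, fixedHom_true] : _ = fixedHom (of (some true)))))
  have hf : of (some false) ^ (-n) = k false := by
    apply fixedHom_injective
    rw [← hn, map_zpow, fixedHom_true, signed, cond_true, mul_assoc, eq_inv_mul_iff_mul_eq,
      ← eq_mul_inv_iff_mul_eq] at h0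
    rw [h0, map_zpow, fixedHom_false, conj_zpow, inv_zpow', neg_neg]
  simp [dataValue, fluxAt, ← hn, ← hf, twistedExp_of_some_zpow, - zpow_neg]

theorem HasData.dataValue_eq {φ : nielsenCentralizer} {e e' : Bool}
    {k k' : Bool → FreeGroup (Option Bool)} {w w' : FreeGroup (Option Bool)}
    (h : HasData φ e k w) (h' : HasData φ e' k' w') : dataValue e k w = dataValue e' k' w' := by
  obtain ⟨e₀, k₀, w₀, h₀⟩ := exists_hasData φ⁻¹
  have h1 := h₀.mul h
  have h2 := h₀.mul h'
  rw [inv_mul_cancel] at h1 h2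
  have h3 := h1.dataValue_one.trans h2.dataValue_one.symm
  rw [dataValue_mul h₀.isUnit_extraExp h.isUnit_extraExp,
    dataValue_mul h₀.isUnit_extraExp h'.isUnit_extraExp] at h3
  exact add_left_cancel h3

/-- The value of the abelianization invariant on the centralizer. -/
noncomputable def centralizerValue (φ : nielsenCentralizer) : ℤ × (ZMod 2 × ZMod 2 × ZMod 2) :=
  dataValue (exists_hasData φ).choose (exists_hasData φ).choose_spec.choose
    (exists_hasData φ).choose_spec.choose_spec.choose

theorem HasData.centralizerValue_eq {φ : nielsenCentralizer} {e : Bool}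
    {k : Bool → FreeGroup (Option Bool)} {w : FreeGroup (Option Bool)} (h : HasData φ e k w) :
    centralizerValue φ = dataValue e k w :=
  HasData.dataValue_eq (exists_hasData φ).choose_spec.choose_spec.choose_spec h

/-- The abelianization invariant as a homomorphism. -/
noncomputable def centralizerHom :
    nielsenCentralizer →* Multiplicative (ℤ × (ZMod 2 × ZMod 2 × ZMod 2)) :=
  MonoidHom.mk' (fun φ => Multiplicative.ofAdd (centralizerValue φ)) fun φ ψ => by
    obtain ⟨e, k, w, h⟩ := exists_hasData φ
    obtain ⟨e', k', w', h'⟩ := exists_hasData ψ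
    rw [(h.mul h').centralizerValue_eq, h.centralizerValue_eq, h'.centralizerValue_eq,
      dataValue_mul h.isUnit_extraExp h'.isUnit_extraExp, ofAdd_add]

theorem HasData.centralizerHom_eq {φ : nielsenCentralizer} {e : Bool}
    {k : Bool → FreeGroup (Option Bool)} {w : FreeGroup (Option Bool)} (h : HasData φ e k w) :
    centralizerHom φ = Multiplicative.ofAdd (dataValue e k w) :=
  congrArg Multiplicative.ofAdd h.centralizerValue_eq

theorem centralizerHom_genL : centralizerHom genL = Multiplicative.ofAdd (1, (0, 0, 0)) := by
  have h : HasData genL true 1 (of (some true) * of none) := by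
    constructor <;> simp [genL, signed]
  rw [h.centralizerHom_eq]
  simp [dataValue, fluxAt]

theorem centralizerHom_genSigma :
    centralizerHom genSigma = Multiplicative.ofAdd (0, (1, 0, 0)) := by
  rw [hasData_genSigma.centralizerHom_eq]
  simp [dataValue, fluxAt]

theorem centralizerHom_genIota :
    centralizerHom genIota = Multiplicative.ofAdd (0, (0, 1, 0)) := by
  rw [hasData_genIota.centralizerHom_eq]
  simp [dataValue, fluxAt]

theorem centralizerHom_genK : centralizerHom genK = Multiplicative.ofAdd (0, (0, 0, 1)) := by
  have h : HasData genK true (Function.update 1 true (of none)) (of none) := by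
    constructor <;> simp [genK, signed]
  rw [h.centralizerHom_eq]
  simp [dataValue, fluxAt]

theorem centralizerHom_genRho : centralizerHom genRho = Multiplicative.ofAdd (2, (0, 0, 0)) := by
  have h : HasData genRho true (Function.update 1 true (of (some true))) (of none) := by
    constructor <;> simp [genRho, signed]
  rw [h.centralizerHom_eq]
  simp [dataValue, fluxAt]

/-- The element of the abelianization given by exponents of the generators. -/
def genPow (n i j l : ℤ) : Abelianization nielsenCentralizer :=
  Abelianization.of genL ^ n * Abelianization.of genSigma ^ i * Abelianization.of genIota ^ j *
    Abelianization.of genK ^ l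

theorem exists_eq_genPow (x : Abelianization nielsenCentralizer) :
    ∃ n i j l, x = genPow n i j l := by
  obtain ⟨φ, rfl⟩ : ∃ φ, Abelianization.of φ = x := QuotientGroup.mk_surjective x
  have hφ : φ ∈ genSubgroup := genSubgroup_eq_top ▸ Subgroup.mem_top φ
  induction hφ using Subgroup.closure_induction with
  | mem φ h =>
    rcases h with rfl | rfl | rfl | rfl
    · exact ⟨1, 0, 0, 0, by simp [genPow]⟩
    · exact ⟨0, 1, 0, 0, by simp [genPow]⟩
    · exact ⟨0, 0, 1, 0, by simp [genPow]⟩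
    · exact ⟨0, 0, 0, 1, by simp [genPow]⟩
  | one => exact ⟨0, 0, 0, 0, by simp [genPow]⟩
  | mul φ ψ _ _ h h' =>
    obtain ⟨n, i, j, l, h⟩ := h
    obtain ⟨n', i', j', l', h'⟩ := h'
    refine ⟨n + n', i + i', j + j', l + l', ?_⟩
    rw [map_mul, h, h']
    simp only [genPow, zpow_add]
    ac_rfl
  | inv φ _ h =>
    obtain ⟨n, i, j, l, h⟩ := h
    refine ⟨-n, -i, -j, -l, ?_⟩
    rw [map_inv, h]
    simp only [genPow, zpow_neg, mul_inv]

theorem lift_centralizerHom_genPow (n i j l : ℤ) :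
    Abelianization.lift centralizerHom (genPow n i j l) =
      Multiplicative.ofAdd (n, ((i : ZMod 2), (j : ZMod 2), (l : ZMod 2))) := by
  simp only [genPow, map_mul, map_zpow, Abelianization.lift_apply_of, centralizerHom_genL,
    centralizerHom_genSigma, centralizerHom_genIota, centralizerHom_genK, ← ofAdd_zsmul,
    ← ofAdd_add]
  simp

theorem lift_centralizerHom_bijective :
    Function.Bijective (Abelianization.lift centralizerHom) := by
  have zpow_eq_one : ∀ {x : Abelianization nielsenCentralizer}, x * x = 1 → ∀ {i : ℤ},
      (i : ZMod 2) = 0 → x ^ i = 1 := by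
    intro x hx i hi
    obtain ⟨m, rfl⟩ := (ZMod.intCast_zmod_eq_zero_iff_dvd i 2).1 hi
    rw [zpow_mul, Nat.cast_ofNat, zpow_ofNat, sq, hx, one_zpow]
  have hσ : Abelianization.of genSigma * Abelianization.of genSigma = 1 := by
    rw [← map_mul, genSigma_mul_self, map_one]
  have hι : Abelianization.of genIota * Abelianization.of genIota = 1 := by
    rw [← map_mul, genIota_mul_self, map_one]
  have hκ : Abelianization.of genK * Abelianization.of genK = 1 := by
    have h := congrArg Abelianization.of genIota_mul_genK
    simp only [map_mul, map_one] at h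
    rwa [mul_right_comm (Abelianization.of genIota), hι, one_mul] at h
  constructor
  · rw [injective_iff_map_eq_one]
    intro x hx
    obtain ⟨n, i, j, l, rfl⟩ := exists_eq_genPow x
    rw [lift_centralizerHom_genPow, ofAdd_eq_one] at hx
    simp only [Prod.mk_eq_zero] at hx
    obtain ⟨rfl, hi, hj, hl⟩ := hx
    rw [genPow, zpow_eq_one hσ hi, zpow_eq_one hι hj, zpow_eq_one hκ hl]
    simp
  · intro t
    obtain ⟨⟨n, i, j, l⟩, rfl⟩ := Multiplicative.ofAdd.surjective t
    obtain ⟨i, rfl⟩ := ZMod.intCast_surjective i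
    obtain ⟨j, rfl⟩ := ZMod.intCast_surjective j
    obtain ⟨l, rfl⟩ := ZMod.intCast_surjective l
    exact ⟨_, lift_centralizerHom_genPow n i j l⟩

theorem eq_nielsen {ρ : MulAut (FreeGroup (Fin 3))} (hρa : ρ (of 0) = of 0 * of 1)
    (hρ : ∀ i : Fin 3, i ≠ 0 → ρ (of i) = of i) : ρ = nielsen := by
  have : ρ.toMonoidHom = nielsen.toMonoidHom := by
    ext i
    fin_cases i
    · simpa using hρa
    · simpa using hρ 1 (by decide)
    · simpa using hρ 2 (by decide)
  ext u
  exact DFunLike.congr_fun this u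

end NielsenCentralizer

/-- for `n = 3` (free group on `{a, b, c₁}`, with `a = of 0`, `b = of 1`,
`c₁ = of 2`), the abelianization of the centralizer of the Nielsen automorphism
`ρ : a ↦ ab, b ↦ b, c₁ ↦ c₁` is isomorphic to `ℤ × (ℤ/2ℤ)³`, with `⟦ρ⟧`
corresponding to `(2,(0,0,0))`; in particular `⟦ρ⟧` has infinite order and is
twice a generator of the infinite cyclic factor. -/
theorem nielsen_centralizer_abelianization_n3
    (ρ : MulAut (FreeGroup (Fin 3)))
    (hρa : ρ (FreeGroup.of 0) = FreeGroup.of 0 * FreeGroup.of 1)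
    (hρ : ∀ i : Fin 3, i ≠ 0 → ρ (FreeGroup.of i) = FreeGroup.of i) :
    ∃ e : Abelianization (Subgroup.centralizer {ρ}) ≃*
        Multiplicative (ℤ × (ZMod 2 × ZMod 2 × ZMod 2)),
      e (Abelianization.of ⟨ρ, mem_centralizer_self ρ⟩) =
        Multiplicative.ofAdd (2, (0, 0, 0)) := by
  obtain rfl := NielsenCentralizer.eq_nielsen hρa hρ
  exact ⟨MulEquiv.ofBijective _ NielsenCentralizer.lift_centralizerHom_bijective,
    NielsenCentralizer.centralizerHom_genRho⟩
end
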